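/- arXiv:1709.09285 — 2 statements merged into one kernel-verified Lean document; each statement's English description precedes it below -/
import Mathlib

section
/- Let G be a finite abelian group with exp(G) ≤ 3, let n ≥ 1, and let S be a finite sequence over G with |S| ≥ n + |G| − 1 and h(S) ≤ n. Suppose that for every proper subgroup H < G and every α ∈ G, at least |G/H| − 1 terms of S lie outside α + H. Then Σ_n(S) = G. -/
/-- The set of `n`-term subsequence sums of the finite sequence (multiset) `S`. -/
def subseqSums {G : Type*} [AddCommGroup G] (S : Multiset G) (n : ℕ) : Set G :=
  {x | ∃ T ≤ S, Multiset.card T = n ∧ T.sum = x}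

namespace SeqSum
open Finset
open scoped Pointwise Classical
universe u
set_option linter.unusedSectionVars false
variable {G : Type u} [AddCommGroup G] [Fintype G]

/-- The finset of elements of a subgroup. -/
noncomputable def elems (H : AddSubgroup G) : Finset G := univ.filter (· ∈ H)

@[simp] lemma mem_elems {H : AddSubgroup G} {x : G} : x ∈ elems H ↔ x ∈ H := by simp [elems]

lemma card_elems_pos (H : AddSubgroup G) : 0 < #(elems H) :=
  card_pos.2 ⟨0, by simp⟩

/-- `C` is a union of cosets of `H`. -/
def IsPeriodic (H : AddSubgroup G) (C : Finset G) : Prop := ∀ h ∈ H, ∀ c ∈ C, h + c ∈ C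

lemma IsPeriodic.add_mem_iff {H : AddSubgroup G} {C : Finset G} (hC : IsPeriodic H C) {h c : G}
    (hh : h ∈ H) : c + h ∈ C ↔ c ∈ C := by
  constructor
  · intro hc
    have := hC (-h) (H.neg_mem hh) _ hc
    simpa using this
  · intro hc
    rw [add_comm]
    exact hC h hh c hc

lemma IsPeriodic.mono {H K : AddSubgroup G} {C : Finset G} (hC : IsPeriodic H C) (hK : K ≤ H) :
    IsPeriodic K C := fun h hh => hC h (hK hh)

lemma IsPeriodic.union {H : AddSubgroup G} {C D : Finset G} (hC : IsPeriodic H C)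
    (hD : IsPeriodic H D) : IsPeriodic H (C ∪ D) := by
  intro h hh c hc
  rcases mem_union.1 hc with hc | hc
  · exact mem_union_left _ (hC h hh c hc)
  · exact mem_union_right _ (hD h hh c hc)

lemma card_mul_card_le_of_add_mem {H₁ H₂ : AddSubgroup G} {X Y E : Finset G} {d : G}
    (hX : ∀ x ∈ X, x ∈ H₁) (hY : ∀ y ∈ Y, y ∈ H₂) (hE : ∀ x ∈ X, ∀ y ∈ Y, d + x + y ∈ E) :
    #X * #Y ≤ #(elems (H₁ ⊓ H₂)) * #E := by
  rw [← card_product]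
  have h := card_le_mul_card_image (f := fun p : G × G => d + p.1 + p.2) (X ×ˢ Y)
    #(elems (H₁ ⊓ H₂)) ?_
  · refine h.trans (Nat.mul_le_mul_left _ (card_le_card ?_))
    intro z hz
    obtain ⟨⟨x, y⟩, hxy, rfl⟩ := mem_image.1 hz
    rw [mem_product] at hxy
    exact hE x hxy.1 y hxy.2
  · intro b hb
    obtain ⟨⟨x₀, y₀⟩, h0, hb0⟩ := mem_image.1 hb
    rw [mem_product] at h0
    refine card_le_card_of_injOn (fun p => p.1 - x₀) ?_ ?_
    · rintro ⟨x, y⟩ hxy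
      simp only [coe_filter, mem_product, Set.mem_ofPred_eq] at hxy
      have e : x - x₀ = y₀ - y := by
        have := hxy.2.trans hb0.symm
        simp only at this
        have h2 : d + x + y - (d + x₀ + y₀) = 0 := by rw [this, sub_self]
        rw [← sub_eq_zero, ← h2]; abel
      simp only [mem_coe, mem_elems, AddSubgroup.mem_inf]
      refine ⟨H₁.sub_mem (hX _ hxy.1.1) (hX _ h0.1), ?_⟩
      rw [e]
      exact H₂.sub_mem (hY _ h0.2) (hY _ hxy.1.2)
    · rintro ⟨x, y⟩ hxy ⟨x', y'⟩ hxy' e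
      simp only [coe_filter, mem_product, Set.mem_ofPred_eq] at hxy hxy'
      simp only [sub_left_inj] at e
      subst e
      have := hxy.2.trans hxy'.2.symm
      simp only [add_right_inj] at this
      rw [this]

lemma grid {H₁ H₂ : AddSubgroup G} {C₁ C₂ : Finset G} (P₁ : IsPeriodic H₁ C₁)
    (P₂ : IsPeriodic H₂ C₂) (hne : ∃ d ∈ C₂, d ∉ C₁) :
    #(elems H₂) ≤ #(C₂ \ C₁) ∨ #(elems H₁) ≤ #(C₂ \ C₁) + #(elems (H₁ ⊓ H₂)) ∨
      #(elems H₂) ≤ #(C₁ \ C₂) + #(elems (H₁ ⊓ H₂)) := by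
  obtain ⟨d, hd2, hd1⟩ := hne
  set A := (elems H₁).filter (fun x => d + x ∈ C₂) with hA
  set Ac := (elems H₁).filter (fun x => ¬ (d + x ∈ C₂)) with hAc
  set B := (elems H₂).filter (fun x => d + x ∈ C₁) with hB
  set Bc := (elems H₂).filter (fun x => ¬ (d + x ∈ C₁)) with hBc
  have e1 : #A + #Ac = #(elems H₁) := card_filter_add_card_filter_not _
  have e2 : #B + #Bc = #(elems H₂) := card_filter_add_card_filter_not _
  set i := #(elems (H₁ ⊓ H₂)) with hi
  have m1 : #A * #Bc ≤ i * #(C₂ \ C₁) := by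
    refine card_mul_card_le_of_add_mem (d := d) (H₁ := H₁) (H₂ := H₂) ?_ ?_ ?_
    · intro x hx; simp [hA] at hx; exact hx.1
    · intro x hx; simp [hBc] at hx; exact hx.1
    · intro x hx y hy
      simp only [hA, hBc, mem_filter, mem_elems] at hx hy
      rw [mem_sdiff, P₂.add_mem_iff hy.1, add_right_comm, P₁.add_mem_iff hx.1]
      exact ⟨hx.2, hy.2⟩
  have m2 : #Ac * #B ≤ i * #(C₁ \ C₂) := by
    refine card_mul_card_le_of_add_mem (d := d) (H₁ := H₁) (H₂ := H₂) ?_ ?_ ?_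
    · intro x hx; simp [hAc] at hx; exact hx.1
    · intro x hx; simp [hB] at hx; exact hx.1
    · intro x hx y hy
      simp only [hAc, hB, mem_filter, mem_elems] at hx hy
      rw [mem_sdiff, P₂.add_mem_iff hy.1, add_right_comm, P₁.add_mem_iff hx.1]
      exact ⟨hy.2, hx.2⟩
  have tr : ∀ (y : G) (D : Finset G), (∀ x ∈ H₁ ⊓ H₂, y + x ∈ D) → i ≤ #D := by
    intro y D h
    refine card_le_card_of_injOn (fun x => y + x) ?_ ?_
    · intro x hx; exact h x (by simpa using hx)
    · intro x _ x' _ e; simpa using e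
  have lA : i ≤ #A := by
    refine tr 0 _ fun x hx => ?_
    simp only [hA, mem_filter, mem_elems, zero_add]
    exact ⟨hx.1, (P₂.add_mem_iff hx.2).2 hd2⟩
  have lBc : i ≤ #Bc := by
    refine tr 0 _ fun x hx => ?_
    simp only [hBc, mem_filter, mem_elems, zero_add]
    exact ⟨hx.2, fun h => hd1 ((P₁.add_mem_iff hx.1).1 h)⟩
  have ipos : 0 < i := card_elems_pos _
  have lAc : #Ac = 0 ∨ i ≤ #Ac := by
    rcases Ac.eq_empty_or_nonempty with h | ⟨y, hy⟩
    · left; simp [h]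
    right
    simp only [hAc, mem_filter, mem_elems] at hy
    refine tr y _ fun x hx => ?_
    simp only [hAc, mem_filter, mem_elems, ← add_assoc]
    exact ⟨H₁.add_mem hy.1 hx.1, fun h => hy.2 ((P₂.add_mem_iff hx.2).1 h)⟩
  have lB : #B = 0 ∨ i ≤ #B := by
    rcases B.eq_empty_or_nonempty with h | ⟨y, hy⟩
    · left; simp [h]
    right
    simp only [hB, mem_filter, mem_elems] at hy
    refine tr y _ fun x hx => ?_
    simp only [hB, mem_filter, mem_elems, ← add_assoc]
    exact ⟨H₂.add_mem hy.1 hx.2, (P₁.add_mem_iff hx.1).2 hy.2⟩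
  rw [← e1, ← e2]
  generalize #A = a at *
  generalize #Ac = ac at *
  generalize #B = b at *
  generalize #Bc = bc at *
  generalize #(C₂ \ C₁) = p at *
  generalize #(C₁ \ C₂) = q at *
  rcases lB with rfl | lB
  · left
    rw [zero_add]
    exact Nat.le_of_mul_le_mul_left ((Nat.mul_le_mul_right bc lA).trans m1) ipos
  rcases lAc with rfl | lAc
  · right; left
    have := (Nat.mul_le_mul_left a lBc).trans m1
    rw [mul_comm] at this
    have := Nat.le_of_mul_le_mul_left this ipos
    omega
  right
  by_contra! hcon
  obtain ⟨c1, c2⟩ := hcon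
  obtain ⟨a, rfl⟩ := Nat.exists_eq_add_of_le lA
  obtain ⟨ac, rfl⟩ := Nat.exists_eq_add_of_le lAc
  obtain ⟨b, rfl⟩ := Nat.exists_eq_add_of_le lB
  obtain ⟨bc, rfl⟩ := Nat.exists_eq_add_of_le lBc
  have c1' : p + 1 ≤ a + ac + i := by omega
  have c2' : q + 1 ≤ b + bc + i := by omega
  have M := Nat.mul_le_mul m1 m2
  have n1 : i * (a + ac + i) ≤ (i + a) * (i + ac) := by nlinarith [Nat.zero_le (a * ac)]
  have n2 : i * (b + bc + i) ≤ (i + b) * (i + bc) := by nlinarith [Nat.zero_le (b * bc)]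
  have N := Nat.mul_le_mul n1 n2
  have L := Nat.mul_le_mul c1' c2'
  have ii : 0 < i * i := by positivity
  have : (i * i) * ((p + 1) * (q + 1)) ≤ (i * i) * (p * q) := by
    calc _ ≤ (i * i) * ((a + ac + i) * (b + bc + i)) := Nat.mul_le_mul_left _ L
      _ = _ := by ring
      _ ≤ _ := N
      _ = _ := by ring
      _ ≤ _ := M
      _ = _ := by ring
  have := Nat.le_of_mul_le_mul_left this ii
  nlinarith

/-- `C` is large compared with one of its periods. -/
def Good (M : ℕ) (C : Finset G) : Prop := ∃ H : AddSubgroup G, IsPeriodic H C ∧ M ≤ #C + #(elems H)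

lemma Good.union {M : ℕ} {C₁ C₂ : Finset G} (h₁ : Good M C₁) (h₂ : Good M C₂) :
    Good M (C₁ ∪ C₂) := by
  obtain ⟨H₁, P₁, l₁⟩ := h₁
  obtain ⟨H₂, P₂, l₂⟩ := h₂
  by_cases s1 : C₂ ⊆ C₁
  · rw [union_eq_left.2 s1]; exact ⟨H₁, P₁, l₁⟩
  by_cases s2 : C₁ ⊆ C₂
  · rw [union_eq_right.2 s2]; exact ⟨H₂, P₂, l₂⟩
  have g1 := grid P₁ P₂ (by simpa [subset_iff] using s1)
  have g2 := grid P₂ P₁ (by simpa [subset_iff] using s2)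
  rw [inf_comm H₂] at g2
  refine ⟨H₁ ⊓ H₂, (P₁.mono inf_le_left).union (P₂.mono inf_le_right), ?_⟩
  have u1 : #(C₁ ∪ C₂) = #C₁ + #(C₂ \ C₁) := by
    rw [← card_union_of_disjoint disjoint_sdiff, union_sdiff_self_eq_union]
  have u2 : #(C₁ ∪ C₂) = #C₂ + #(C₁ \ C₂) := by
    rw [union_comm, ← card_union_of_disjoint disjoint_sdiff, union_sdiff_self_eq_union]
  omega

lemma Good.of_forall_mem {M : ℕ} {Z : Finset G} (hne : Z.Nonempty)
    (h : ∀ z ∈ Z, ∃ C ⊆ Z, z ∈ C ∧ Good M C) : Good M Z := by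
  have hF : (Z.powerset.filter (Good M)).Nonempty := by
    obtain ⟨z, hz⟩ := hne
    obtain ⟨C, hC, -, hg⟩ := h z hz
    exact ⟨C, by simp [hC, hg]⟩
  obtain ⟨C, hC, hmax⟩ := exists_max_image _ card hF
  simp only [mem_filter, mem_powerset] at hC hmax
  suffices C = Z by rw [← this]; exact hC.2
  refine subset_antisymm hC.1 fun z hz => ?_
  obtain ⟨D, hD, hzD, hg⟩ := h z hz
  have := hmax (C ∪ D) ⟨union_subset hC.1 hD, hC.2.union hg⟩
  rw [eq_of_subset_of_card_le subset_union_left this]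
  exact mem_union_right _ hzD

lemma exists_good_subset_add (B : Finset G) : ∀ (A : Finset G) (a b : G), a ∈ A → b ∈ B →
    ∃ C ⊆ A + B, a + b ∈ C ∧ Good (#A + #B) C := by
  induction B using Finset.strongInduction with
  | _ B ih =>
  intro A a b ha hb
  by_cases hall : ∀ a' ∈ A, ∀ b' ∈ B, a' - b + b' ∈ A
  · refine ⟨A.image (· + b), ?_, mem_image_of_mem _ ha, AddAction.stabilizer G A, ?_, ?_⟩
    · intro x hx
      obtain ⟨y, hy, rfl⟩ := mem_image.1 hx
      exact add_mem_add hy hb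
    · intro h hh c hc
      obtain ⟨y, hy, rfl⟩ := mem_image.1 hc
      rw [AddAction.mem_stabilizer_finset'] at hh
      exact mem_image.2 ⟨h + y, hh hy, by abel⟩
    · rw [card_image_of_injective _ (add_left_injective b)]
      refine Nat.add_le_add_left (card_le_card_of_injOn (fun x => x - b) ?_
        (fun x _ y _ e => by simpa using e)) _
      intro x hx
      simp only [mem_coe, mem_elems]
      rw [AddAction.mem_stabilizer_finset']
      intro y hy
      have := hall y hy x hx
      rw [vadd_eq_add]
      convert this using 1; abel
  · push Not at hall
    obtain ⟨a', ha', b', hb', hn⟩ := hall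
    set e := a' - b with he
    have hbm : b ∈ B.filter (fun x => x + e ∈ A) := by
      simp [hb, he, ha']
    obtain ⟨C, hC, hm, hg⟩ := ih (B.filter (fun x => x + e ∈ A)) (by
      refine ⟨filter_subset _ _, fun h => ?_⟩
      have := h hb'
      simp only [mem_filter] at this
      exact hn (by rw [add_comm]; exact this.2)) (A ∪ B.image (· + e)) a b
        (mem_union_left _ ha) hbm
    refine ⟨C, hC.trans ?_, hm, ?_⟩
    · intro z hz
      obtain ⟨x, hx, y, hy, rfl⟩ := mem_add.1 hz
      simp only [mem_filter] at hy
      rcases mem_union.1 hx with hx | hx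
      · exact add_mem_add hx hy.1
      · obtain ⟨w, hw, rfl⟩ := mem_image.1 hx
        rw [add_assoc, add_comm e, add_comm w]
        exact add_mem_add hy.2 hw
    · convert hg using 1
      have h1 := card_union_add_card_inter A (B.image (· + e))
      rw [card_image_of_injective _ (add_left_injective e)] at h1
      have h2 : #(A ∩ B.image (· + e)) = #(B.filter (fun x => x + e ∈ A)) := by
        rw [← card_image_of_injective (B.filter _) (add_left_injective e)]
        congr 1
        ext x
        simp only [mem_inter, mem_image, mem_filter]
        constructor
        · rintro ⟨h, w, hw, rfl⟩; exact ⟨w, ⟨hw, h⟩, rfl⟩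
        · rintro ⟨w, ⟨hw, h⟩, rfl⟩; exact ⟨h, w, hw, rfl⟩
      omega

lemma good_add {A B : Finset G} (hA : A.Nonempty) (hB : B.Nonempty) :
    Good (#A + #B) (A + B) := by
  refine Good.of_forall_mem (hA.add hB) fun z hz => ?_
  obtain ⟨a, ha, b, hb, rfl⟩ := mem_add.1 hz
  exact exists_good_subset_add B A a b ha hb

/-- The union of the `K`-cosets that meet `A`. -/
noncomputable def clos (K : AddSubgroup G) (A : Finset G) : Finset G :=
  univ.filter fun x => ∃ a ∈ A, x - a ∈ K

lemma mem_clos {K : AddSubgroup G} {A : Finset G} {x : G} :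
    x ∈ clos K A ↔ ∃ a ∈ A, x - a ∈ K := by simp [clos]

lemma clos_eq (K : AddSubgroup G) (A : Finset G) : clos K A = elems K + A := by
  ext x
  simp only [mem_clos, mem_add, mem_elems]
  constructor
  · rintro ⟨a, ha, h⟩; exact ⟨_, h, a, ha, by abel⟩
  · rintro ⟨k, hk, a, ha, rfl⟩; exact ⟨a, ha, by simpa using hk⟩

lemma subset_clos (K : AddSubgroup G) (A : Finset G) : A ⊆ clos K A :=
  fun a ha => mem_clos.2 ⟨a, ha, by simp⟩

/-- `C` has trivial stabilizer. -/
def Aperiodic (C : Finset G) : Prop := ∀ g : G, (∀ c ∈ C, g + c ∈ C) → g = 0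

lemma Aperiodic.eq_bot {C : Finset G} (hC : Aperiodic C) {H : AddSubgroup G}
    (hH : IsPeriodic H C) : H = ⊥ := by
  rw [eq_bot_iff]
  intro h hh
  exact hC h (hH h hh)

lemma card_elems_bot : #(elems (⊥ : AddSubgroup G)) = 1 := by
  have : elems (⊥ : AddSubgroup G) = {0} := by ext; simp
  simp [this]

lemma Good.le_of_aperiodic {M : ℕ} {C : Finset G} (h : Good M C) (hC : Aperiodic C) :
    M ≤ #C + 1 := by
  obtain ⟨H, P, l⟩ := h
  rw [hC.eq_bot P, card_elems_bot] at l
  exact l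

lemma kneser_aperiodic {A B : Finset G} (hA : A.Nonempty) (hB : B.Nonempty)
    (h : Aperiodic (A + B)) : #A + #B ≤ #(A + B) + 1 :=
  (good_add hA hB).le_of_aperiodic h

/-- The stabilizer of a finset. -/
noncomputable def stab (C : Finset G) : AddSubgroup G := AddAction.stabilizer G C

lemma mem_stab {C : Finset G} {g : G} : g ∈ stab C ↔ ∀ c ∈ C, g + c ∈ C := by
  rw [stab, AddAction.mem_stabilizer_finset']; rfl

lemma isPeriodic_stab (C : Finset G) : IsPeriodic (stab C) C := fun _ hh => mem_stab.1 hh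

lemma IsPeriodic.le_stab {C : Finset G} {H : AddSubgroup G} (h : IsPeriodic H C) : H ≤ stab C :=
  fun g hg => mem_stab.2 (h g hg)

lemma aperiodic_iff {C : Finset G} : Aperiodic C ↔ stab C = ⊥ :=
  ⟨fun h => h.eq_bot (isPeriodic_stab C), fun h g hg => by
    have : g ∈ stab C := mem_stab.2 hg
    rw [h] at this; exact this⟩

lemma clos_add_clos {K : AddSubgroup G} {A B : Finset G} (h : IsPeriodic K (A + B)) :
    clos K A + clos K B = A + B := by
  refine subset_antisymm ?_ (add_subset_add (subset_clos _ _) (subset_clos _ _))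
  intro x hx
  obtain ⟨y, hy, z, hz, rfl⟩ := mem_add.1 hx
  obtain ⟨a, ha, hk⟩ := mem_clos.1 hy
  obtain ⟨b, hb, hk'⟩ := mem_clos.1 hz
  have := h _ (K.add_mem hk hk') _ (add_mem_add ha hb)
  convert this using 1; abel

lemma clos_nonempty {K : AddSubgroup G} {A : Finset G} (h : A.Nonempty) : (clos K A).Nonempty :=
  h.mono (subset_clos K A)

lemma kneser {A B : Finset G} (hA : A.Nonempty) (hB : B.Nonempty) :
    #(clos (stab (A + B)) A) + #(clos (stab (A + B)) B) ≤ #(A + B) + #(elems (stab (A + B))) := by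
  have e := clos_add_clos (isPeriodic_stab (A + B))
  obtain ⟨H, P, l⟩ := good_add (clos_nonempty (K := stab (A + B)) hA)
    (clos_nonempty (K := stab (A + B)) hB)
  rw [e] at P l
  refine l.trans ?_
  gcongr
  intro x hx
  rw [mem_elems] at *
  exact P.le_stab hx

lemma clos_mono_right {K : AddSubgroup G} {A B : Finset G} (h : A ⊆ B) : clos K A ⊆ clos K B := by
  intro x hx
  obtain ⟨a, ha, hk⟩ := mem_clos.1 hx
  exact mem_clos.2 ⟨a, h ha, hk⟩

lemma isPeriodic_clos (K : AddSubgroup G) (A : Finset G) : IsPeriodic K (clos K A) := by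
  intro h hh c hc
  obtain ⟨a, ha, hk⟩ := mem_clos.1 hc
  exact mem_clos.2 ⟨a, ha, by rw [add_sub_assoc]; exact K.add_mem hh hk⟩

lemma clos_subset_of_isPeriodic {K : AddSubgroup G} {A C : Finset G} (hC : IsPeriodic K C)
    (h : A ⊆ C) : clos K A ⊆ C := by
  intro x hx
  obtain ⟨a, ha, hk⟩ := mem_clos.1 hx
  have := hC _ hk a (h ha)
  simpa using this

lemma clos_stab_clos (K : AddSubgroup G) (A : Finset G) :
    clos (stab (clos K A)) A = clos K A := by
  refine (clos_subset_of_isPeriodic (isPeriodic_stab _) (subset_clos _ _)).antisymm ?_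
  intro x hx
  obtain ⟨a, ha, hk⟩ := mem_clos.1 hx
  exact mem_clos.2 ⟨a, ha, (isPeriodic_clos K A).le_stab hk⟩

lemma clos_add (K : AddSubgroup G) (A B : Finset G) : clos K (A + B) = clos K A + clos K B := by
  refine subset_antisymm ?_ ?_
  · intro x hx
    obtain ⟨y, hy, hk⟩ := mem_clos.1 hx
    obtain ⟨a, ha, b, hb, rfl⟩ := mem_add.1 hy
    exact mem_add.2 ⟨x - b, mem_clos.2 ⟨a, ha, by convert hk using 1; abel⟩, b,
      subset_clos _ _ hb, by abel⟩
  · intro x hx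
    obtain ⟨y, hy, z, hz, rfl⟩ := mem_add.1 hx
    obtain ⟨a, ha, hk⟩ := mem_clos.1 hy
    obtain ⟨b, hb, hk'⟩ := mem_clos.1 hz
    refine mem_clos.2 ⟨a + b, add_mem_add ha hb, ?_⟩
    convert K.add_mem hk hk' using 1; abel

lemma stab_le_stab_add (A B : Finset G) : stab A ≤ stab (A + B) := by
  intro g hg
  rw [mem_stab] at *
  intro c hc
  obtain ⟨a, ha, b, hb, rfl⟩ := mem_add.1 hc
  rw [← add_assoc]
  exact add_mem_add (hg a ha) hb

lemma stab_clos_left {K : AddSubgroup G} {A B : Finset G} (h : stab (clos K (A + B)) = K) :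
    stab (clos K A) = K := by
  refine le_antisymm ?_ (isPeriodic_clos K A).le_stab
  conv_rhs => rw [← h, clos_add]
  exact stab_le_stab_add _ _

lemma stab_clos_right {K : AddSubgroup G} {A B : Finset G} (h : stab (clos K (A + B)) = K) :
    stab (clos K B) = K := stab_clos_left (by rwa [add_comm] at h)

lemma card_elems_mono {H K : AddSubgroup G} (h : H ≤ K) : #(elems H) ≤ #(elems K) :=
  card_le_card fun x hx => by rw [mem_elems] at *; exact h hx

lemma kneser_clos {K : AddSubgroup G} {A B : Finset G} (hA : A.Nonempty) (hB : B.Nonempty)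
    (h : stab (clos K (A + B)) = K) :
    #(clos K A) + #(clos K B) ≤ #(clos K (A + B)) + #(elems K) := by
  obtain ⟨H, P, l⟩ := good_add (clos_nonempty (K := K) hA) (clos_nonempty (K := K) hB)
  rw [← clos_add] at P l
  exact l.trans (Nat.add_le_add_left (card_elems_mono (P.le_stab.trans h.le)) _)

lemma clos_zero (K : AddSubgroup G) : clos K 0 = elems K := by
  ext x; simp [mem_clos]

lemma sum_nonempty {κ : Type*} {T : Finset κ} {B : κ → Finset G}
    (hB : ∀ q ∈ T, (B q).Nonempty) : (∑ q ∈ T, B q).Nonempty := by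
  induction T using Finset.induction_on with
  | empty => simp
  | insert a T ha ih =>
    rw [sum_insert ha]
    exact (hB a (mem_insert_self _ _)).add (ih fun q hq => hB q (mem_insert_of_mem hq))

lemma kneser_clos_sum {K : AddSubgroup G} {κ : Type*} (T : Finset κ) (B : κ → Finset G)
    (hB : ∀ q ∈ T, (B q).Nonempty) (h : stab (clos K (∑ q ∈ T, B q)) = K) :
    ∑ q ∈ T, #(clos K (B q)) + #(elems K) ≤ #(clos K (∑ q ∈ T, B q)) + #T * #(elems K) := by
  induction T using Finset.induction_on with
  | empty => simp [clos_zero]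
  | insert a T ha ih =>
    rw [sum_insert ha] at h
    rw [sum_insert ha, sum_insert ha, card_insert_of_notMem ha]
    have hB' : ∀ q ∈ T, (B q).Nonempty := fun q hq => hB q (mem_insert_of_mem hq)
    have h1 := ih hB' (stab_clos_right h)
    have h2 := kneser_clos (hB a (mem_insert_self _ _)) (sum_nonempty hB') h
    rw [add_mul, one_mul]
    omega

lemma stab_clos_of_mem_sum {K : AddSubgroup G} {κ : Type*} {T : Finset κ} {B : κ → Finset G}
    (h : stab (clos K (∑ q ∈ T, B q)) = K) {q : κ} (hq : q ∈ T) : stab (clos K (B q)) = K := by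
  rw [← add_sum_erase _ _ hq] at h
  exact stab_clos_left h

/-- The set of sums of `f` over `n`-element subsets of `s`. -/
noncomputable def sums {ι : Type*} (s : Finset ι) (n : ℕ) (f : ι → G) : Finset G :=
  (s.powersetCard n).image fun I => ∑ i ∈ I, f i

section sums
variable {ι : Type*}

lemma mem_sums {s : Finset ι} {n : ℕ} {f : ι → G} {x : G} :
    x ∈ sums s n f ↔ ∃ I ⊆ s, #I = n ∧ ∑ i ∈ I, f i = x := by
  simp [sums, and_assoc]

lemma sums_nonempty {s : Finset ι} {n : ℕ} (f : ι → G) (h : n ≤ #s) : (sums s n f).Nonempty := by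
  obtain ⟨I, hI, hc⟩ := exists_subset_card_eq h
  exact ⟨_, mem_sums.2 ⟨I, hI, hc, rfl⟩⟩

lemma sums_zero (s : Finset ι) (f : ι → G) : sums s 0 f = 0 := by
  ext x; simp [sums]

lemma sums_add_subset {s₁ s₂ s : Finset ι} {n₁ n₂ : ℕ} {f : ι → G} (h : Disjoint s₁ s₂)
    (h₁ : s₁ ⊆ s) (h₂ : s₂ ⊆ s) : sums s₁ n₁ f + sums s₂ n₂ f ⊆ sums s (n₁ + n₂) f := by
  intro x hx
  obtain ⟨y, hy, z, hz, rfl⟩ := mem_add.1 hx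
  obtain ⟨I, hI, hc, rfl⟩ := mem_sums.1 hy
  obtain ⟨J, hJ, hc', rfl⟩ := mem_sums.1 hz
  have hd : Disjoint I J := disjoint_of_subset_left hI (disjoint_of_subset_right hJ h)
  refine mem_sums.2 ⟨I ∪ J, union_subset (hI.trans h₁) (hJ.trans h₂), ?_, sum_union hd⟩
  rw [card_union_of_disjoint hd, hc, hc']

lemma sum_sums_subset {κ : Type*} (c : ι → κ) (s : Finset ι) (t : κ → ℕ) (f : ι → G)
    (T : Finset κ) : ∑ q ∈ T, sums (s.filter fun i => c i = q) (t q) f ⊆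
      sums (s.filter fun i => c i ∈ T) (∑ q ∈ T, t q) f := by
  induction T using Finset.induction_on with
  | empty => simp [sums_zero]
  | insert a T ha ih =>
    rw [sum_insert ha, sum_insert ha]
    refine (add_subset_add_left ih).trans (sums_add_subset ?_ ?_ ?_)
    · rw [disjoint_filter]
      rintro i - rfl
      exact ha
    · intro i; simp only [mem_filter, mem_insert]; tauto
    · intro i; simp only [mem_filter, mem_insert]; tauto

lemma sum_mem_sum_sums {κ : Type*} (c : ι → κ) {s I : Finset ι} (hI : I ⊆ s) (f : ι → G)
    (T : Finset κ) : ∑ i ∈ I.filter (fun i => c i ∈ T), f i ∈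
      ∑ q ∈ T, sums (s.filter fun i => c i = q) #(I.filter fun i => c i = q) f := by
  induction T using Finset.induction_on with
  | empty => simp
  | insert a T ha ih =>
    rw [sum_insert ha]
    have : I.filter (fun i => c i ∈ insert a T) =
        I.filter (fun i => c i = a) ∪ I.filter (fun i => c i ∈ T) := by
      ext i; simp only [mem_filter, mem_insert, mem_union]; tauto
    rw [this, sum_union]
    · refine add_mem_add (mem_sums.2 ⟨_, filter_subset_filter _ hI, rfl, rfl⟩) ih
    · rw [disjoint_filter]
      rintro i - rfl
      exact ha

lemma sub_mem_of_mem_sums {K : AddSubgroup G} {s : Finset ι} {n : ℕ} {f : ι → G}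
    (h : ∀ i ∈ s, ∀ j ∈ s, f i - f j ∈ K) {x y : G} (hx : x ∈ sums s n f) (hy : y ∈ sums s n f) :
    x - y ∈ K := by
  obtain ⟨I, hI, hc, rfl⟩ := mem_sums.1 hx
  obtain ⟨J, hJ, hc', rfl⟩ := mem_sums.1 hy
  rcases I.eq_empty_or_nonempty with rfl | ⟨i, hi⟩
  · have : J = ∅ := by rw [← card_eq_zero, hc', ← hc, card_empty]
    simp [this]
  have aux : ∀ L ⊆ s, #L = n → ∑ j ∈ L, f j - n • f i ∈ K := by
    intro L hL hn
    rw [← hn, ← sum_const, ← sum_sub_distrib]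
    exact sum_mem fun j hj => h _ (hL hj) _ (hI hi)
  have := K.sub_mem (aux I hI hc) (aux J hJ hc')
  simpa using this

lemma sub_mem_of_mem_sum_sums {K : AddSubgroup G} {κ : Type*} (c : ι → κ) {s : Finset ι}
    {t : κ → ℕ} {f : ι → G} (T : Finset κ)
    (h : ∀ i ∈ s, ∀ j ∈ s, c i = c j → f i - f j ∈ K) {x y : G}
    (hx : x ∈ ∑ q ∈ T, sums (s.filter fun i => c i = q) (t q) f)
    (hy : y ∈ ∑ q ∈ T, sums (s.filter fun i => c i = q) (t q) f) : x - y ∈ K := by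
  induction T using Finset.induction_on generalizing x y with
  | empty => simp at hx hy; simp [hx, hy]
  | insert a T ha ih =>
    rw [sum_insert ha] at hx hy
    obtain ⟨x₁, h1, x₂, h2, rfl⟩ := mem_add.1 hx
    obtain ⟨y₁, h3, y₂, h4, rfl⟩ := mem_add.1 hy
    have := K.add_mem (sub_mem_of_mem_sums (K := K) (fun i hi j hj => by
      simp only [mem_filter] at hi hj
      exact h i hi.1 j hj.1 (hi.2.trans hj.2.symm)) h1 h3) (ih h2 h4)
    convert this using 1; abel

/-- The number of indices in `s` whose value lies in the coset `x + K`. -/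
noncomputable def cnt (s : Finset ι) (f : ι → G) (K : AddSubgroup G) (x : G) : ℕ :=
  #(s.filter fun i => f i - x ∈ K)

lemma sum_cnt (s : Finset ι) (f : ι → G) (K : AddSubgroup G) :
    ∑ x, cnt s f K x = #s * #(elems K) := by
  simp only [cnt, card_filter]
  rw [sum_comm, ← smul_eq_mul, ← sum_const]
  refine sum_congr rfl fun i _ => ?_
  rw [← card_filter]
  refine card_bij (fun x _ => f i - x) ?_ ?_ ?_
  · intro x hx; simpa using hx
  · intro x _ y _ e; simpa using e
  · intro y hy; exact ⟨f i - y, by simpa using hy, by abel⟩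

lemma cnt_mono {s : Finset ι} {f : ι → G} {K L : AddSubgroup G} (h : K ≤ L) (x : G) :
    cnt s f K x ≤ cnt s f L x :=
  card_le_card fun i hi => by
    simp only [mem_filter] at *
    exact ⟨hi.1, h hi.2⟩

lemma cnt_subset {s t : Finset ι} {f : ι → G} {K : AddSubgroup G} (h : s ⊆ t) (x : G) :
    cnt s f K x ≤ cnt t f K x := card_le_card (filter_subset_filter _ h)

end sums

section sums
variable {ι : Type*}

/-- The lower bound on the number of subsequence sums, measured modulo `K`, under the assumption
that `K` is the stabilizer. -/
def SumsBound (s : Finset ι) (n : ℕ) (f : ι → G) (K : AddSubgroup G) : Prop :=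
  stab (clos K (sums s n f)) = K → ∑ x, min n (cnt s f K x) + #(elems K) ≤
    #(clos K (sums s n f)) + n * #(elems K)

lemma exists_class (K : AddSubgroup G) :
    ∃ (κ : Type u) (c : G → κ), ∀ x y, c x = c y ↔ x - y ∈ K :=
  ⟨G ⧸ K, QuotientAddGroup.mk, fun x y => by
    rw [eq_comm, QuotientAddGroup.eq, neg_add_eq_sub]⟩

lemma exists_periodic_piece {s I : Finset ι} {f : ι → G} {K₀ K : AddSubgroup G}
    (ih : ∀ s' : Finset ι, #s' < #s → ∀ n ≤ #s', ∀ L, SumsBound s' n f L)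
    (hI : I ⊆ s) (hK : K₀ ≤ K) (hne : ∃ i ∈ s, ∃ j ∈ s, f i - f j ∉ K) :
    ∃ K₁ ≤ K, K₀ ≤ K₁ ∧ ∃ Y ⊆ clos K₀ (sums s #I f), ∑ i ∈ I, f i ∈ Y ∧
      (∀ y ∈ Y, y - ∑ i ∈ I, f i ∈ K) ∧ IsPeriodic K₁ Y ∧
      ∑ x, min (cnt I f K x) (cnt s f K₁ x) + #(elems K₁) ≤ #Y + #I * #(elems K₁) := by
  obtain ⟨κ, c, hcc⟩ := exists_class K
  set T : Finset κ := univ.image c with hT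
  have hmT : ∀ x, c x ∈ T := fun x => mem_image_of_mem _ (mem_univ _)
  set t : κ → ℕ := fun q => #(I.filter fun i => c (f i) = q) with ht
  set sq : κ → Finset ι := fun q => s.filter fun i => c (f i) = q with hsq
  have ht' : ∀ x, t (c x) = cnt I f K x := by
    intro x; simp only [ht, cnt, hcc]
  have hsum : ∑ q ∈ T, t q = #I :=
    (card_eq_sum_card_fiberwise (f := fun i => c (f i)) (fun i _ => hmT _)).symm
  set P := ∑ q ∈ T, sums (sq q) (t q) f with hP
  have hPs : P ⊆ sums s #I f := by
    have := sum_sums_subset (fun i => c (f i)) s t f T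
    rw [hsum] at this
    simpa only [hmT, filter_true] using this
  have hzP : ∑ i ∈ I, f i ∈ P := by
    have := sum_mem_sum_sums (fun i => c (f i)) hI f T
    simpa only [hmT, filter_true] using this
  have hPK : ∀ y ∈ P, y - ∑ i ∈ I, f i ∈ K := fun y hy =>
    sub_mem_of_mem_sum_sums (fun i => c (f i)) T (fun i _ j _ h => (hcc _ _).1 h) hy hzP
  set Y := clos K₀ P with hY
  set K₁ := stab Y with hK₁
  have hYz : ∀ y ∈ Y, y - ∑ i ∈ I, f i ∈ K := by
    intro y hy
    obtain ⟨p, hp, h⟩ := mem_clos.1 hy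
    have := K.add_mem (hK h) (hPK p hp)
    simpa using this
  have hzY := subset_clos K₀ P hzP
  have hle : K₁ ≤ K := by
    intro g hg
    have := hYz _ (mem_stab.1 hg _ hzY)
    simpa using this
  have hcl : clos K₁ P = Y := clos_stab_clos K₀ P
  have hst : stab (clos K₁ P) = K₁ := by rw [hcl]
  have hlt : ∀ q, #(sq q) < #s := by
    intro q
    refine card_lt_card ⟨filter_subset _ _, fun h => ?_⟩
    obtain ⟨i, hi, j, hj, hij⟩ := hne
    have h1 := h hi
    have h2 := h hj
    simp only [hsq, mem_filter] at h1 h2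
    exact hij ((hcc _ _).1 (h1.2.trans h2.2.symm))
  have htle : ∀ q, t q ≤ #(sq q) := fun q => card_le_card (filter_subset_filter _ hI)
  have hb : ∀ q ∈ T, ∑ x, min (t q) (cnt (sq q) f K₁ x) + #(elems K₁) ≤
      #(clos K₁ (sums (sq q) (t q) f)) + t q * #(elems K₁) := fun q hq =>
    ih _ (hlt q) _ (htle q) _ (stab_clos_of_mem_sum hst hq)
  have hkn := kneser_clos_sum T (fun q => sums (sq q) (t q) f)
    (fun q _ => sums_nonempty f (htle q)) hst
  rw [← hP, hcl] at hkn
  have hs1 := sum_le_sum hb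
  rw [sum_add_distrib, sum_add_distrib, ← sum_mul, hsum, sum_const, smul_eq_mul] at hs1
  have hs2 : ∑ x, min (cnt I f K x) (cnt s f K₁ x) ≤
      ∑ q ∈ T, ∑ x, min (t q) (cnt (sq q) f K₁ x) := by
    rw [← sum_fiberwise_of_maps_to (t := T) (g := c) (fun x _ => hmT x)]
    refine sum_le_sum fun q _ => ?_
    refine (sum_le_sum ?_).trans (sum_le_sum_of_subset (filter_subset _ _))
    intro x hx
    obtain rfl := (mem_filter.1 hx).2
    rw [ht']
    refine min_le_min_left _ (card_le_card ?_)
    intro i hi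
    simp only [mem_filter, hsq, hcc] at *
    exact ⟨⟨hi.1, hle hi.2⟩, hi.2⟩
  refine ⟨K₁, hle, (isPeriodic_clos K₀ P).le_stab, Y, clos_mono_right hPs, hzY, hYz,
    isPeriodic_stab _, ?_⟩
  omega

lemma exists_transversal {s : Finset ι} {n : ℕ} (f : ι → G) (K : AddSubgroup G) (hn : 1 ≤ n)
    (hs : n ≤ #s) : ∃ α ⊆ s, α.Nonempty ∧
      ((∃ i, α = {i}) ∨ ∀ i ∈ α, n - 1 ≤ cnt (s \ α) f K (f i)) ∧
      ∀ x, n ≤ cnt s f K x → ∃ i ∈ α, f i - x ∈ K := by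
  by_cases hbig : ∃ x, n ≤ cnt s f K x
  swap
  · obtain ⟨i, hi⟩ := card_pos.1 (hn.trans hs)
    refine ⟨{i}, by simpa using hi, by simp, Or.inl ⟨i, rfl⟩, fun x hx => (hbig ⟨x, hx⟩).elim⟩
  obtain ⟨κ, c, hcc⟩ := exists_class K
  have hr : ∀ q : κ, ∃ j : ι, (∃ i ∈ s, c (f i) = q) → j ∈ s ∧ c (f j) = q := by
    intro q
    by_cases h : ∃ i ∈ s, c (f i) = q
    · obtain ⟨i, hi⟩ := h; exact ⟨i, fun _ => hi⟩
    · obtain ⟨i, hi⟩ := card_pos.1 (hn.trans hs)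
      exact ⟨i, fun h' => (h h').elim⟩
  choose r hr using hr
  have hr' : ∀ i ∈ s, r (c (f i)) ∈ s ∧ c (f (r (c (f i)))) = c (f i) := fun i hi =>
    hr _ ⟨i, hi, rfl⟩
  have hex : ∀ x, n ≤ cnt s f K x → ∃ i ∈ s, c (f i) = c x := by
    intro x hx
    obtain ⟨i, hi⟩ := card_pos.1 (hn.trans hx)
    rw [mem_filter] at hi
    exact ⟨i, hi.1, (hcc _ _).2 hi.2⟩
  have hcnt : ∀ x y, c x = c y → cnt s f K x = cnt s f K y := by
    intro x y hxy
    simp only [cnt, ← hcc, hxy]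
  set α := (s.filter fun i => n ≤ cnt s f K (f i)).image fun i => r (c (f i)) with hα
  have hαx : ∀ x, n ≤ cnt s f K x → ∃ i ∈ α, f i - x ∈ K := by
    intro x hx
    obtain ⟨i, hi, he⟩ := hex x hx
    refine ⟨r (c (f i)), mem_image.2 ⟨i, mem_filter.2 ⟨hi, by rwa [hcnt _ _ he]⟩, rfl⟩, ?_⟩
    rw [← hcc, (hr' i hi).2, he]
  have hαmem : ∀ j ∈ α, j ∈ s ∧ r (c (f j)) = j ∧ n ≤ cnt s f K (f j) := by
    intro j hj
    obtain ⟨i, hi, rfl⟩ := mem_image.1 hj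
    rw [mem_filter] at hi
    have := hr' i hi.1
    exact ⟨this.1, by rw [this.2], by rw [hcnt _ _ this.2]; exact hi.2⟩
  refine ⟨α, fun j hj => (hαmem j hj).1, ?_, Or.inr ?_, hαx⟩
  · obtain ⟨x, hx⟩ := hbig
    obtain ⟨i, hi, -⟩ := hαx x hx
    exact ⟨i, hi⟩
  · intro i hi
    obtain ⟨-, h2, h3⟩ := hαmem i hi
    refine (Nat.sub_le_sub_right h3 1).trans ?_
    refine (pred_card_le_card_erase (a := i)).trans (card_le_card ?_)
    intro j hj
    simp only [mem_erase, mem_filter, mem_sdiff] at *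
    refine ⟨⟨hj.2.1, fun hjα => hj.1 ?_⟩, hj.2.2⟩
    rw [← (hαmem j hjα).2.1, ← h2, (hcc _ _).2 hj.2.2]

theorem sumsBound (s : Finset ι) (f : ι → G) :
    ∀ n ≤ #s, ∀ K, SumsBound s n f K := by
  induction hm : #s using Nat.strong_induction_on generalizing s with
  | _ m ih =>
  subst hm
  replace ih : ∀ s' : Finset ι, #s' < #s → ∀ n ≤ #s', ∀ L, SumsBound s' n f L :=
    fun s' h => ih _ h s' rfl
  intro n hns K₀ hst
  rcases Nat.eq_zero_or_pos n with rfl | hn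
  · simp [sums_zero, clos_zero]
  obtain ⟨α, hαs, hαne, hα, hαx⟩ := exists_transversal f K₀ hn hns
  set Z := clos K₀ (sums s n f) with hZ
  set cap : AddSubgroup G → G → ℕ := fun K x => if ∃ i ∈ α, f i - x ∈ K then n else n - 1
    with hcap
  set u : AddSubgroup G → G → ℕ := fun K x => min (cap K x) (cnt s f K x) with hu
  set F := Z.powerset.filter fun C => C.Nonempty ∧ ∃ K, K₀ ≤ K ∧ IsPeriodic K C ∧
    ∑ x, u K x ≤ #C + (n - 1) * #(elems K) with hF
  have hFne : F.Nonempty := by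
    have hlt : #(s \ α) < #s := card_lt_card (sdiff_ssubset hαs hαne)
    have hle : n - 1 ≤ #(s \ α) := by
      rcases hα with ⟨i, rfl⟩ | hα
      · rw [card_sdiff_of_subset hαs, card_singleton]; omega
      · obtain ⟨i, hi⟩ := hαne
        exact (hα i hi).trans (card_filter_le _ _)
    set A := α.image f with hA
    set B := sums (s \ α) (n - 1) f with hB
    have hBne : B.Nonempty := sums_nonempty f hle
    have hABZ : A + B ⊆ sums s n f := by
      intro x hx
      obtain ⟨y, hy, z, hz, rfl⟩ := mem_add.1 hx
      obtain ⟨i, hi, rfl⟩ := mem_image.1 hy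
      obtain ⟨J, hJ, hc, rfl⟩ := mem_sums.1 hz
      have hiJ : i ∉ J := fun h => (mem_sdiff.1 (hJ h)).2 hi
      refine mem_sums.2 ⟨insert i J, ?_, ?_, sum_insert hiJ⟩
      · exact insert_subset (hαs hi) (hJ.trans sdiff_subset)
      · rw [card_insert_of_notMem hiJ, hc]; omega
    set C := clos K₀ (A + B) with hC
    set K := stab C with hK
    have hcl : clos K (A + B) = C := clos_stab_clos _ _
    have hstK : stab (clos K (A + B)) = K := by rw [hcl]
    have h1 := kneser_clos (hαne.image f) hBne hstK
    have h2 := ih _ hlt _ hle K (stab_clos_right hstK)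
    rw [← hB] at h2
    rw [hcl, ← hA] at h1
    refine ⟨C, mem_filter.2 ⟨mem_powerset.2 (clos_mono_right hABZ), ?_, K,
      (isPeriodic_clos _ _).le_stab, isPeriodic_stab _, ?_⟩⟩
    · exact clos_nonempty ((hαne.image f).add hBne)
    have h3 : #(clos K A) = ∑ x, if ∃ i ∈ α, f i - x ∈ K then 1 else 0 := by
      rw [← card_filter]
      congr 1
      ext x
      simp only [mem_clos, hA, mem_filter, mem_univ, true_and, mem_image, exists_exists_and_eq_and]
      refine exists_congr fun i => and_congr_right fun _ => ?_
      rw [← K.neg_mem_iff, neg_sub]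
    have h4 : ∑ x, u K x ≤ #(clos K A) + ∑ x, min (n - 1) (cnt (s \ α) f K x) := by
      rw [h3, ← sum_add_distrib]
      refine sum_le_sum fun x _ => ?_
      have h5 : cnt s f K x = cnt (s \ α) f K x + cnt α f K x := by
        simp only [cnt]
        rw [← card_union_of_disjoint (disjoint_filter_filter sdiff_disjoint), ← filter_union,
          sdiff_union_of_subset hαs]
      simp only [hu, hcap]
      by_cases h6 : ∃ i ∈ α, f i - x ∈ K
      · rw [if_pos h6, if_pos h6]
        rcases hα with ⟨i, rfl⟩ | hα
        · have h7 : cnt {i} f K x ≤ 1 := (card_filter_le _ _).trans (by simp)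
          omega
        · obtain ⟨i, hi, hix⟩ := h6
          have h7 : n - 1 ≤ cnt (s \ α) f K x := by
            refine (hα i hi).trans (card_le_card fun j hj => ?_)
            simp only [mem_filter] at *
            have := K.add_mem ((isPeriodic_clos K₀ (A + B)).le_stab hj.2) hix
            exact ⟨hj.1, by simpa using this⟩
          omega
      · rw [if_neg h6, if_neg h6]
        have h7 : cnt α f K x = 0 := by
          rw [cnt, card_eq_zero, filter_eq_empty_iff]
          intro i hi h
          exact h6 ⟨i, hi, h⟩
        omega
    omega
  obtain ⟨C, hCF, hmax⟩ := exists_max_image F card hFne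
  obtain ⟨hCZ, ⟨c₀, hc₀⟩, K, hK₀, hper, hbd⟩ := mem_filter.1 hCF
  rw [mem_powerset] at hCZ
  have hCeq : C = Z := by
    by_contra hne
    obtain ⟨z', hz', hzC'⟩ := exists_of_ssubset (lt_of_le_of_ne hCZ hne)
    obtain ⟨z, hz, hzz⟩ := mem_clos.1 hz'
    have hzC : z ∉ C := fun h => hzC' (by simpa using hper _ (hK₀ hzz) _ h)
    obtain ⟨I, hI, hIc, rfl⟩ := mem_sums.1 hz
    subst hIc
    obtain ⟨K₁, hK₁, hK₀₁, Y, hYZ, hzY, hYK, hYper, hYb⟩ := exists_periodic_piece ih hI hK₀ (by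
      by_contra! hcon
      obtain ⟨c₁, hc₁, hcc⟩ := mem_clos.1 (hCZ hc₀)
      have h1 := sub_mem_of_mem_sums hcon hz hc₁
      have h2 := K.sub_mem h1 (hK₀ hcc)
      apply hzC
      have := hper _ h2 _ hc₀
      convert this using 1; abel)
    have hdis : Disjoint C Y := by
      rw [disjoint_left]
      intro y hy hyY
      apply hzC
      have := hper _ (K.neg_mem (hYK y hyY)) _ hy
      simpa using this
    have hcard := card_union_of_disjoint hdis
    have hYpos : 0 < #Y := card_pos.2 ⟨_, hzY⟩
    refine absurd (hmax (C ∪ Y) (mem_filter.2 ⟨?_, ⟨c₀, mem_union_left _ hc₀⟩, K₁, hK₀₁,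
      (hper.mono hK₁).union hYper, ?_⟩)) (by omega)
    · exact mem_powerset.2 (union_subset hCZ hYZ)
    have hx : ∀ x, u K₁ x + cnt I f K x ≤ u K x + min (cnt I f K x) (cnt s f K₁ x) +
        if cnt I f K x = #I then 1 else 0 := by
      intro x
      have a1 : cnt s f K₁ x ≤ cnt s f K x := cnt_mono hK₁ x
      have a2 : cnt I f K x ≤ cnt s f K x := cnt_subset hI x
      have a3 : cnt I f K x ≤ #I := card_filter_le _ _
      have a4 : cap K₁ x ≤ cap K x := by
        simp only [hcap]
        split_ifs with h1 h2
        · exact le_rfl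
        · obtain ⟨i, hi, h⟩ := h1
          exact (h2 ⟨i, hi, hK₁ h⟩).elim
        · omega
        · exact le_rfl
      have a5 : #I - 1 ≤ cap K x := by
        simp only [hcap]
        split_ifs <;> omega
      simp only [hu]
      split_ifs <;> omega
    have hxs := sum_le_sum fun x (_ : x ∈ univ) => hx x
    rw [sum_add_distrib, sum_add_distrib, sum_add_distrib, sum_cnt, ← card_filter] at hxs
    have hlast : #(univ.filter fun x => cnt I f K x = #I) ≤ #(elems K) := by
      obtain ⟨i, hi⟩ := card_pos.1 hn
      refine card_le_card_of_injOn (fun x => f i - x) ?_ (fun x _ y _ e => by simpa using e)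
      intro x hx
      simp only [coe_filter, mem_univ, true_and, Set.mem_ofPred_eq, cnt,
        card_filter_eq_iff] at hx
      simpa using hx i hi
    obtain ⟨k, hk⟩ := Nat.exists_eq_add_of_le' hn
    have e : ∀ m, #I * m = k * m + m := fun m => by rw [hk]; ring
    have e' : #I - 1 = k := by omega
    rw [e'] at hbd ⊢
    rw [e] at hYb hxs
    omega
  have hKeq : K = K₀ := by
    refine le_antisymm ?_ hK₀
    rw [← hst, ← hCeq]
    exact hper.le_stab
  subst hKeq
  rw [hCeq] at hbd
  have hmin : ∀ x, min n (cnt s f K x) ≤ u K x := by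
    intro x
    simp only [hu, hcap]
    split_ifs with h
    · exact le_rfl
    · have : ¬ n ≤ cnt s f K x := fun h' => h (hαx x h')
      omega
  have := sum_le_sum fun x (_ : x ∈ univ) => hmin x
  have e : n * #(elems K) = (n - 1) * #(elems K) + #(elems K) := by
    rw [← add_one_mul, Nat.sub_add_cancel (Nat.one_le_iff_ne_zero.2 hn.ne')]
  omega

end sums

/-- Every nontrivial proper closure of `X` is substantially larger than `X`. -/
def HoleFree (X : Finset G) : Prop :=
  ∀ K : AddSubgroup G, K ≠ ⊥ → K ≠ ⊤ → #X + #(elems K) ≤ #(clos K X)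

lemma HoleFree.card_add_card_le {X F : Finset G} (hX : HoleFree X) (hXn : X.Nonempty)
    (hF : F.Nonempty) (h : F + X ≠ univ) : #F + #X ≤ #(F + X) + 1 := by
  by_cases h1 : stab (F + X) = ⊥
  · exact kneser_aperiodic hF hXn (aperiodic_iff.2 h1)
  by_cases h2 : stab (F + X) = ⊤
  · refine (h (eq_univ_of_forall fun x => ?_)).elim
    obtain ⟨c, hc⟩ := hF.add hXn
    have : x - c ∈ stab (F + X) := by rw [h2]; trivial
    simpa using mem_stab.1 this c hc
  have := hX _ h1 h2
  have := kneser hF hXn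
  have := card_le_card (subset_clos (stab (F + X)) F)
  omega

/-- `F + X` is as small as possible. -/
structure Critical (X F : Finset G) : Prop where
  nonempty : F.Nonempty
  ne_univ : F + X ≠ univ
  card_le : #(F + X) + 1 ≤ #F + #X

lemma mem_singleton_add {F : Finset G} {g x : G} : x ∈ {g} + F ↔ x - g ∈ F := by
  rw [mem_add]
  constructor
  · rintro ⟨y, hy, z, hz, rfl⟩
    rw [mem_singleton.1 hy]
    simpa using hz
  · intro h; exact ⟨g, by simp, _, h, by simp⟩

lemma singleton_add_eq_iff {F : Finset G} {g : G} : {g} + F = F ↔ g ∈ stab F := by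
  rw [mem_stab]
  constructor
  · intro h c hc
    rw [← h, mem_singleton_add]
    simpa using hc
  · intro h
    refine eq_of_subset_of_card_le ?_ (by rw [card_singleton_add])
    intro x hx
    have := h _ (mem_singleton_add.1 hx)
    simpa using this

lemma Critical.singleton_add {X F : Finset G} (h : Critical X F) (g : G) :
    Critical X ({g} + F) := by
  refine ⟨(singleton_nonempty g).add h.nonempty, ?_, ?_⟩
  · rw [add_assoc]
    intro he
    apply h.ne_univ
    rw [← card_eq_iff_eq_univ, ← card_singleton_add g (F + X), he, card_univ]
  · rw [add_assoc, card_singleton_add, card_singleton_add]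
    exact h.card_le

lemma card_union_add_card_inter_add {X V W : Finset G} :
    #((V ∪ W) + X) + #((V ∩ W) + X) ≤ #(V + X) + #(W + X) := by
  rw [← card_union_add_card_inter (V + X), union_add]
  exact Nat.add_le_add_left (card_le_card inter_add_subset) _

lemma Critical.union {X V W : Finset G} (hX : HoleFree X) (hXn : X.Nonempty)
    (hV : Critical X V) (hW : Critical X W) (hVW : (V ∩ W).Nonempty) (h : (V ∪ W) + X ≠ univ) :
    Critical X (V ∪ W) ∧ Critical X (V ∩ W) := by
  have h1 := card_union_add_card_inter_add (X := X) (V := V) (W := W)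
  have hi : (V ∩ W) + X ≠ univ := by
    intro he
    apply hV.ne_univ
    rw [eq_univ_iff_forall] at *
    exact fun x => add_subset_add_right inter_subset_left (he x)
  have hun : (V ∪ W).Nonempty := hV.nonempty.mono subset_union_left
  have h2 := hX.card_add_card_le hXn hun h
  have h3 := hX.card_add_card_le hXn hVW hi
  have h4 := card_union_add_card_inter V W
  have h5 := hV.card_le
  have h6 := hW.card_le
  exact ⟨⟨hun, h, by omega⟩, ⟨hVW, hi, by omega⟩⟩

lemma Critical.not_coset {X F : Finset G} (hX : HoleFree X) (hXn : X.Nonempty)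
    (hF : Critical X F) (hc : 2 ≤ #F) : ¬ ∀ m₁ ∈ F, ∀ m₂ ∈ F, m₂ - m₁ ∈ stab F := by
  intro h
  obtain ⟨m, hm⟩ := hF.nonempty
  have hFe : F = {m} + elems (stab F) := by
    ext x
    rw [mem_singleton_add, mem_elems]
    refine ⟨fun hx => h m hm x hx, fun hx => ?_⟩
    simpa using mem_stab.1 hx m hm
  have hcard : #F = #(elems (stab F)) := by
    conv_lhs => rw [hFe]
    rw [card_singleton_add]
  have hsum : #(F + X) = #(clos (stab F) X) := by
    rw [clos_eq]
    conv_lhs => rw [hFe]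
    rw [add_assoc, card_singleton_add]
  have h1 : stab F ≠ ⊥ := by
    intro h; rw [h, card_elems_bot] at hcard; omega
  have h2 : stab F ≠ ⊤ := by
    intro h
    apply hF.ne_univ
    rw [← card_eq_iff_eq_univ, hsum, h]
    obtain ⟨x, hx⟩ := hXn
    rw [card_eq_iff_eq_univ, eq_univ_iff_forall]
    intro y
    exact mem_clos.2 ⟨x, hx, trivial⟩
  have := hX _ h1 h2
  have := hF.card_le
  omega

/-- Distinct translates of `F` share at most one element. -/
def IsSidon (F : Finset G) : Prop := ∀ g ≠ 0, #(F ∩ ({g} + F)) ≤ 1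

structure Admissible (X A : Finset G) : Prop where
  two_le : 2 ≤ #A
  card_add : #(A + X) + 2 ≤ Fintype.card G
  card_lt : #(A + X) < #A + #X

lemma Admissible.critical {X A : Finset G} (h : Admissible X A) : Critical X A := by
  refine ⟨card_pos.1 (by have := h.two_le; omega), ?_, h.card_lt⟩
  rw [Ne, ← card_eq_iff_eq_univ]
  have := h.card_add
  omega

/-- The dual fragment, consisting of the negatives of the elements missed by `F + X`. -/
lemma Admissible.dual {X F : Finset G} (h : Admissible X F)
    (he : #F + #X ≤ #(F + X) + 1) :
    ∃ D, Admissible X D ∧ #D + #(F + X) = Fintype.card G := by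
  have hD : #(-(F + X)ᶜ) + #(F + X) = Fintype.card G := by
    rw [card_neg, add_comm, card_add_card_compl]
  have hDX : #(-(F + X)ᶜ + X) + #F ≤ Fintype.card G := by
    rw [← card_neg F, ← card_union_of_disjoint]
    · exact card_le_univ _
    · rw [disjoint_left]
      intro z hz hzF
      obtain ⟨y, hy, x, hx, rfl⟩ := mem_add.1 hz
      rw [mem_neg'] at hy hzF
      rw [mem_compl] at hy
      apply hy
      have := add_mem_add hzF hx
      convert this using 1; abel
  have h1 := h.two_le
  have h2 := h.card_add
  have h3 := h.card_lt
  exact ⟨_, ⟨by omega, by omega, by omega⟩, hD⟩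

lemma HoleFree.exists_fragment {X A : Finset G} (hX : HoleFree X) (hXn : X.Nonempty)
    (hA : Admissible X A) :
    ∃ F, Admissible X F ∧ ∀ g, {g} + F ≠ F → #(F ∩ ({g} + F)) ≤ 1 := by
  obtain ⟨F, hF, hmin⟩ := exists_min_image (univ.filter (Admissible X)) card ⟨A, by simpa using hA⟩
  simp only [mem_filter, mem_univ, true_and] at hF hmin
  refine ⟨F, hF, fun g hg => ?_⟩
  by_contra! hcon
  have hC := hF.critical
  have hC' := hC.singleton_add g
  have hi : (F ∩ ({g} + F)).Nonempty := card_pos.1 (by omega)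
  have hlt : #(F ∩ ({g} + F)) < #F := by
    refine lt_of_le_of_ne (card_le_card inter_subset_left) fun h => hg ?_
    have := eq_of_subset_of_card_le inter_subset_left h.ge
    exact (eq_of_subset_of_card_le (inter_eq_left.1 this) (by rw [card_singleton_add])).symm
  have hisub : #((F ∩ ({g} + F)) + X) ≤ #(F + X) :=
    card_le_card (add_subset_add_right inter_subset_left)
  by_cases hU : (F ∪ ({g} + F)) + X = univ
  · obtain ⟨D, hD, hDc⟩ := hF.dual (hX.card_add_card_le hXn hC.nonempty hC.ne_univ)
    have h1 := hmin D hD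
    have h2 := card_union_add_card_inter_add (X := X) (V := F) (W := {g} + F)
    rw [hU, card_univ, add_assoc, card_singleton_add] at h2
    have h3 : (F ∩ ({g} + F)) + X ≠ univ := by
      rw [Ne, ← card_eq_iff_eq_univ]
      have := hF.card_add
      omega
    have h4 := hX.card_add_card_le hXn hi h3
    have h5 := hC.card_le
    omega
  · have h1 := (hC.union hX hXn hC' hi hU).2
    have h2 := hF.card_add
    have h3 := h1.card_le
    have := hmin _ ⟨hcon, by omega, by omega⟩
    omega

lemma HoleFree.exists_sidon {X A : Finset G} (hX : HoleFree X) (hXn : X.Nonempty)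
    (hA : Admissible X A) (hexp : (∀ g : G, g + g = 0) ∨ ∀ g : G, g + g + g = 0) :
    (∀ g : G, g + g + g = 0) ∧ ∃ F, Admissible X F ∧ IsSidon F := by
  obtain ⟨F, hF, hg⟩ := hX.exists_fragment hXn hA
  have hnc := hF.critical.not_coset hX hXn hF.two_le
  rcases hexp with h2 | h3
  · refine (hnc fun m₁ h₁ m₂ h₂ => ?_).elim
    by_cases he : m₁ = m₂
    · rw [he, sub_self]; exact zero_mem _
    rw [← singleton_add_eq_iff]
    by_contra hne
    have := hg _ hne
    rw [card_le_one] at this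
    refine he (this m₁ ?_ m₂ ?_)
    · rw [mem_inter, mem_singleton_add]
      refine ⟨h₁, ?_⟩
      have e : m₁ - (m₂ - m₁) = m₁ + m₁ - (m₂ + m₂) + m₂ := by abel
      rw [e, h2, h2]; simpa using h₂
    · rw [mem_inter, mem_singleton_add]
      exact ⟨h₂, by simpa using h₁⟩
  · refine ⟨h3, F, hF, fun g hg0 => hg g fun he => hnc fun m₁ h₁ m₂ h₂ => ?_⟩
    rw [← singleton_add_eq_iff]
    by_contra hne
    have := hg _ hne
    rw [card_le_one] at this
    rw [singleton_add_eq_iff, mem_stab] at he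
    have := this m₂ (by
      rw [mem_inter, mem_singleton_add]
      exact ⟨h₂, by simpa using h₁⟩) (g + m₂) (by
      rw [mem_inter, mem_singleton_add]
      refine ⟨he _ h₂, ?_⟩
      have := he _ h₁
      convert this using 1; abel)
    exact hg0 (by simpa using this)

lemma HoleFree.three_le {X F : Finset G} (hX : HoleFree X) (hXn : X.Nonempty)
    (hF : Admissible X F) (h3 : ∀ g : G, g + g + g = 0) : 3 ≤ #F := by
  have h2 := hF.two_le
  by_contra! hlt
  obtain ⟨a, b, hab, rfl⟩ := card_eq_two.1 (show #F = 2 by omega)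
  set c := b - a with hc
  have hc0 : c ≠ 0 := sub_ne_zero.2 hab.symm
  set K := AddSubgroup.zmultiples c with hK
  have hKel : elems K = {0, c, c + c} := by
    ext x
    simp only [mem_elems, mem_insert, mem_singleton, hK, AddSubgroup.mem_zmultiples_iff]
    constructor
    · rintro ⟨k, rfl⟩
      have h3c : (3 : ℤ) • c = 0 := by
        rw [← h3 c]; module
      have hk : k • c = (k % 3) • c := by
        conv_lhs => rw [← Int.emod_add_mul_ediv k 3]
        rw [add_zsmul, mul_comm, mul_zsmul, h3c, zsmul_zero, add_zero]
      rw [hk]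
      have h1 := Int.emod_nonneg k (by norm_num : (3 : ℤ) ≠ 0)
      have h2 := Int.emod_lt_of_pos k (by norm_num : (0 : ℤ) < 3)
      interval_cases k % 3
      · left; simp
      · right; left; simp
      · right; right; rw [two_zsmul]
    · rintro (rfl | rfl | rfl)
      · exact ⟨0, by simp⟩
      · exact ⟨1, by simp⟩
      · exact ⟨2, by rw [two_zsmul]⟩
  have hcc : c + c ≠ 0 := by
    intro h
    have := h3 c
    rw [h, zero_add] at this
    exact hc0 this
  have hK3 : #(elems K) = 3 := by
    rw [hKel, card_eq_three]
    exact ⟨0, c, c + c, hc0.symm, hcc.symm, by simpa using hc0, rfl⟩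
  have hKb : K ≠ ⊥ := by
    intro h; rw [h, card_elems_bot] at hK3; omega
  have hKt : K ≠ ⊤ := by
    intro h
    have : Fintype.card G = 3 := by
      rw [← hK3, h, ← card_univ]; congr 1; ext; simp
    have h4 := hF.card_add
    have h5 := hF.card_lt
    have h6 : #({a, b} : Finset G) ≤ #({a, b} + X) := card_le_card_add_right hXn
    rw [card_pair hab] at h6
    omega
  have hfree := hX K hKb hKt
  rw [clos_eq, hKel] at hfree
  have e1 : ({a, b} : Finset G) + X = {a} + ({0, c} + X) := by
    rw [← add_assoc]
    congr 1
    ext x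
    simp only [mem_singleton_add, mem_insert, mem_singleton, hc, sub_eq_zero, sub_left_inj]
  have h5 := hF.card_lt
  rw [e1, card_singleton_add, card_pair hab] at h5
  set Y := {0, c} + X with hY
  have e2 : ({0, c, c + c} : Finset G) + X = Y ∪ ({c} + Y) := by
    rw [hY, ← add_assoc, ← union_add]
    congr 1
    ext x
    simp only [mem_union, mem_singleton_add, mem_insert, mem_singleton,
      sub_eq_iff_eq_add, zero_add]
    tauto
  have e3 : #X ≤ #(Y ∩ ({c} + Y)) := by
    rw [← card_singleton_add c X]
    refine card_le_card (subset_inter ?_ ?_)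
    · exact add_subset_add_right (by simp)
    · refine add_subset_add_left ?_
      intro x hx
      exact mem_add.2 ⟨0, by simp, x, hx, by simp⟩
  have e4 := card_union_add_card_inter Y ({c} + Y)
  rw [card_singleton_add] at e4
  rw [hKel] at hK3
  rw [e2, hK3] at hfree
  omega

lemma Critical.closure_eq_top {X F : Finset G} (hX : HoleFree X) (hXn : X.Nonempty)
    (hF : Critical X F) (hF2 : 2 ≤ #F) {L : AddSubgroup G}
    (hL : ∀ a ∈ F, ∀ b ∈ F, a - b ∈ L) : L = ⊤ := by
  by_contra hLt
  obtain ⟨V, hV, hmax⟩ := exists_max_image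
    (univ.filter fun V => F ⊆ V ∧ Critical X V ∧ ∀ a ∈ V, ∀ b ∈ V, a - b ∈ L) card
    ⟨F, by simpa using ⟨hF, hL⟩⟩
  simp only [mem_filter, mem_univ, true_and] at hV hmax
  obtain ⟨hFV, hVc, hVL⟩ := hV
  have hV2 : 2 ≤ #V := hF2.trans (card_le_card hFV)
  refine hVc.not_coset hX hXn hV2 fun m₁ h₁ m₂ h₂ => ?_
  rw [← singleton_add_eq_iff]
  by_contra hne
  set W := {m₂ - m₁} + V with hW
  have hVW : (V ∩ W).Nonempty :=
    ⟨m₂, mem_inter.2 ⟨h₂, mem_singleton_add.2 (by simpa using h₁)⟩⟩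
  have hWL : ∀ a ∈ V ∪ W, ∀ b ∈ V ∪ W, a - b ∈ L := by
    have : ∀ a ∈ V ∪ W, a - m₁ ∈ L := by
      intro a ha
      rcases mem_union.1 ha with ha | ha
      · exact hVL a ha _ h₁
      · have := L.add_mem (hVL _ (mem_singleton_add.1 ha) _ h₁) (hVL _ h₂ _ h₁)
        convert this using 1; abel
    intro a ha b hb
    simpa using L.sub_mem (this a ha) (this b hb)
  have hWc : Critical X W := hVc.singleton_add (m₂ - m₁)
  have hWcard : #W = #V := card_singleton_add _ _
  by_cases hU : (V ∪ W) + X = univ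
  · have h1 := card_union_add_card_inter_add (X := X) (V := V) (W := W)
    have h2 := card_union_add_card_inter V W
    have h3 : (V ∩ W) + X ≠ univ := by
      intro he
      apply hVc.ne_univ
      rw [eq_univ_iff_forall] at *
      exact fun x => add_subset_add_right inter_subset_left (he x)
    have h4 := hX.card_add_card_le hXn hVW h3
    have h5 := hVc.card_le
    have h6 := hWc.card_le
    have hLb : L ≠ ⊥ := by
      rintro rfl
      obtain ⟨a, ha, b, hb, hab⟩ := one_lt_card.1 hF2
      exact hab (sub_eq_zero.1 (hL a ha b hb))
    have h7 := hX L hLb hLt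
    have h8 : #(V ∪ W) ≤ #(elems L) := by
      refine card_le_card_of_injOn (fun x => x - m₁) ?_ (fun x _ y _ e => by simpa using e)
      intro x hx
      rw [mem_coe, mem_elems]
      exact hWL x hx _ (mem_union_left _ h₁)
    have h9 : #(clos L X) ≤ #((V ∪ W) + X) := by
      rw [hU]; exact card_le_card (subset_univ _)
    omega
  · have h1 := hmax (V ∪ W) ⟨hFV.trans subset_union_left, (hVc.union hX hXn hWc hVW hU).1, hWL⟩
    have h2 := eq_of_subset_of_card_le subset_union_left h1
    have h3 : W ⊆ V := by rw [h2]; exact subset_union_right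
    exact hne (eq_of_subset_of_card_le h3 (by rw [hW, card_singleton_add]))

lemma card_coset_inter {K : AddSubgroup G} {F : Finset G} {x y : G} (hxy : x - y ∉ K) :
    #(elems K) + #(elems K) + #F ≤ #(F.filter fun z => z - x ∈ K) +
      #(F.filter fun z => z - y ∈ K) + #(clos K F) ∨ x ∉ F ∨ y ∉ F := by
  by_cases hx : x ∈ F
  swap
  · simp [hx]
  by_cases hy : y ∈ F
  swap
  · simp [hy]
  left
  have hcard : ∀ x, #(univ.filter fun z => z - x ∈ K) = #(elems K) := by
    intro x
    refine card_bij (fun z _ => z - x) (by simp) (by simp) ?_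
    intro b hb
    exact ⟨b + x, by simpa using hb, by simp⟩
  rw [← hcard x]
  conv_lhs => enter [1, 2]; rw [hcard x, ← hcard y]
  have hd : ∀ E : Finset G,
      Disjoint (E.filter fun z => z - x ∈ K) (E.filter fun z => z - y ∈ K) := by
    intro E
    rw [disjoint_filter]
    intro z _ h1 h2
    have := K.sub_mem h2 h1
    exact hxy (by simpa using this)
  rw [← card_union_of_disjoint (hd _), ← card_union_of_disjoint (hd _), ← filter_or, ← filter_or]
  rw [← card_union_add_card_inter, add_comm]
  refine Nat.add_le_add ?_ (card_le_card ?_)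
  · refine card_le_card ?_
    intro z
    simp only [mem_inter, mem_filter, mem_univ, true_and]
    tauto
  · intro z hz
    rcases mem_union.1 hz with hz | hz
    · simp only [mem_filter, mem_univ, true_and] at hz
      rcases hz with hz | hz
      · exact mem_clos.2 ⟨x, hx, hz⟩
      · exact mem_clos.2 ⟨y, hy, hz⟩
    · exact subset_clos _ _ hz

lemma IsSidon.holeFree {F : Finset G} (hS : IsSidon F)
    (hF : ∀ L : AddSubgroup G, (∀ a ∈ F, ∀ b ∈ F, a - b ∈ L) → L = ⊤) : HoleFree F := by
  intro K hKb hKt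
  by_contra! hlt
  obtain ⟨x, hx, y, hy, hxy⟩ : ∃ x ∈ F, ∃ y ∈ F, x - y ∉ K := by
    by_contra! h
    exact hKt (hF K h)
  have h1 := (card_coset_inter (F := F) hxy).resolve_right (by simp [hx, hy])
  have hd : Disjoint (F.filter fun z => z - x ∈ K) (F.filter fun z => z - y ∈ K) := by
    rw [disjoint_filter]
    intro z _ h1 h2
    have := K.sub_mem h2 h1
    exact hxy (by simpa using this)
  have h2 : #(F.filter fun z => z - x ∈ K) + #(F.filter fun z => z - y ∈ K) ≤ #F := by
    rw [← card_union_of_disjoint hd]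
    exact card_le_card (union_subset (filter_subset _ _) (filter_subset _ _))
  obtain ⟨g, hg, hg0⟩ := (AddSubgroup.bot_or_exists_ne_zero K).resolve_left hKb
  have h3 := hS g hg0
  have h4 := card_union_add_card_inter F ({g} + F)
  rw [card_singleton_add] at h4
  have h5 : #(F ∪ ({g} + F)) ≤ #(clos K F) := by
    refine card_le_card (union_subset (subset_clos _ _) fun z hz => ?_)
    rw [mem_singleton_add] at hz
    exact mem_clos.2 ⟨_, hz, by simpa using hg⟩
  omega

lemma IsSidon.card_add_ge {F T : Finset G} (hS : IsSidon F) (hF : 3 ≤ #F) (hT : 2 ≤ #T)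
    (hTF : #T ≤ #F) : #F + #T ≤ #(T + F) := by
  have key : ∀ (T : Finset G) (a : G), a ∉ T →
      #(T + F) + #F ≤ #(insert a T + F) + #T := by
    intro T a ha
    have h1 : insert a T + F = (T + F) ∪ ({a} + F) := by
      rw [insert_eq, union_add, union_comm]
    have h2 := card_union_add_card_inter (T + F) ({a} + F)
    have h3 : #((T + F) ∩ ({a} + F)) ≤ #T := by
      have : (T + F) ∩ ({a} + F) ⊆ T.biUnion fun t => ({t} + F) ∩ ({a} + F) := by
        intro z hz
        obtain ⟨hz1, hz2⟩ := mem_inter.1 hz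
        obtain ⟨t, ht, x, hx, rfl⟩ := mem_add.1 hz1
        exact mem_biUnion.2 ⟨t, ht, mem_inter.2 ⟨mem_singleton_add.2 (by simpa using hx), hz2⟩⟩
      refine (card_le_card this).trans ((card_biUnion_le_card_mul _ _ 1 fun t ht => ?_).trans
        (mul_one _).le)
      refine (card_le_card_of_injOn (t := F ∩ ({a - t} + F)) (fun x => x - t) ?_
        (fun x _ y _ e => by simpa using e)).trans (hS _ ?_)
      · intro x hx
        simp only [mem_coe, mem_inter, mem_singleton_add] at hx ⊢
        refine ⟨hx.1, ?_⟩
        convert hx.2 using 1; abel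
      · rw [sub_ne_zero]
        rintro rfl
        exact ha ht
    rw [card_singleton_add] at h2
    rw [h1]
    omega
  induction T using Finset.induction_on with
  | empty => simp at hT
  | insert a T ha ih =>
    have h1 := key T a ha
    rw [card_insert_of_notMem ha] at hT hTF ⊢
    rcases Nat.lt_or_ge #T 2 with h2 | h2
    · have h3 : #F ≤ #(T + F) := card_le_card_add_left (card_pos.1 (by omega))
      omega
    · have := ih h2 (by omega)
      omega

/-- Adding a set without holes to another set increases the size by the full amount, unless the
sum is almost everything. -/
theorem HoleFree.card_add_card_le_card_add {X A : Finset G} (hX : HoleFree X) (hX2 : 2 ≤ #X)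
    (hexp : (∀ g : G, g + g = 0) ∨ ∀ g : G, g + g + g = 0) (hA : 2 ≤ #A)
    (hAX : #(A + X) + 2 ≤ Fintype.card G) : #A + #X ≤ #(A + X) := by
  by_contra! hlt
  have hXn : X.Nonempty := card_pos.1 (by omega)
  obtain ⟨h3, F, hF, hFS⟩ := hX.exists_sidon hXn ⟨hA, hAX, hlt⟩ hexp
  have hFn := hF.critical.nonempty
  have hF3 := hX.three_le hXn hF h3
  have hFX : HoleFree F := hFS.holeFree fun L hL =>
    hF.critical.closure_eq_top hX hXn hF.two_le hL
  have hXF : Admissible F X := by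
    refine ⟨hX2, ?_, ?_⟩
    · rw [add_comm X]; exact hF.card_add
    · rw [add_comm X, add_comm #X]; exact hF.card_lt
  obtain ⟨-, L, hL, hLS⟩ := hFX.exists_sidon hFn hXF hexp
  have hL3 := hFX.three_le hFn hL h3
  have h1 := hL.card_lt
  rcases le_total #L #F with h | h
  · have := hFS.card_add_ge hF3 hL.two_le h
    omega
  · have := hLS.card_add_ge hL3 hF.two_le h
    rw [add_comm F] at this
    omega

lemma add_mem_add_self_of_card_lt {K : AddSubgroup G} {X : Finset G} {x y k : G} (hk : k ∈ K)
    (h : #(elems K) < #(X.filter fun z => z - x ∈ K) + #(X.filter fun z => z - y ∈ K)) :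
    x + y + k ∈ X + X := by
  have h1 : #((X.filter fun z => z - x ∈ K).image fun z => z - x) =
      #(X.filter fun z => z - x ∈ K) := card_image_of_injective _ fun a b e => by simpa using e
  have h2 : #((X.filter fun z => z - y ∈ K).image fun z => y + k - z) =
      #(X.filter fun z => z - y ∈ K) := card_image_of_injective _ fun a b e => by simpa using e
  have h3 : ((X.filter fun z => z - x ∈ K).image (fun z => z - x) ∩
      (X.filter fun z => z - y ∈ K).image fun z => y + k - z).Nonempty := by
    rw [nonempty_iff_ne_empty, Ne, ← disjoint_iff_inter_eq_empty]
    intro hd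
    have h4 := card_union_of_disjoint hd
    rw [h1, h2] at h4
    rw [← h4] at h
    refine h.not_ge (card_le_card (union_subset ?_ ?_))
    · intro z hz
      obtain ⟨w, hw, rfl⟩ := mem_image.1 hz
      exact mem_elems.2 (mem_filter.1 hw).2
    · intro z hz
      obtain ⟨w, hw, rfl⟩ := mem_image.1 hz
      rw [mem_elems]
      have := K.sub_mem hk (mem_filter.1 hw).2
      convert this using 1; abel
  obtain ⟨z, hz⟩ := h3
  obtain ⟨hl, hr⟩ := mem_inter.1 hz
  obtain ⟨a, ha, rfl⟩ := mem_image.1 hl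
  obtain ⟨b, hb, hab⟩ := mem_image.1 hr
  refine mem_add.2 ⟨a, (mem_filter.1 ha).1, b, (mem_filter.1 hb).1, ?_⟩
  have : a + b = (a - x) + x + b := by abel
  rw [this, ← hab]; abel

lemma isPeriodic_add_add_self {K : AddSubgroup G} {X : Finset G}
    (hexp : (∀ g : G, g + g = 0) ∨ ∀ g : G, g + g + g = 0)
    (hK : #(clos K X) < #X + #(elems K)) (hne : ∃ x ∈ X, ∃ y ∈ X, x - y ∉ K) :
    IsPeriodic K (X + X + X) := by
  have hpair : ∀ x ∈ X, ∀ y ∈ X, x - y ∉ K →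
      #(elems K) < #(X.filter fun z => z - x ∈ K) + #(X.filter fun z => z - y ∈ K) := by
    intro x hx y hy hxy
    have := (card_coset_inter (F := X) hxy).resolve_right (by simp [hx, hy])
    omega
  have hdiff : ∀ x ∈ X, ∀ y ∈ X, ∀ k ∈ K, x - y ∉ K → x + y + k ∈ X + X :=
    fun x hx y hy k hk hxy => add_mem_add_self_of_card_lt hk (hpair x hx y hy hxy)
  intro h hh c hc
  obtain ⟨w, hw, x₃, h3, rfl⟩ := mem_add.1 hc
  obtain ⟨x₁, h1, x₂, h2, rfl⟩ := mem_add.1 hw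
  by_cases h12 : x₁ - x₂ ∈ K
  swap
  · have := add_mem_add (hdiff _ h1 _ h2 h hh h12) h3
    convert this using 1; abel
  by_cases h13 : x₁ - x₃ ∈ K
  swap
  · have := add_mem_add (hdiff _ h1 _ h3 h hh h13) h2
    convert this using 1; abel
  obtain ⟨y, hy, hxy⟩ : ∃ y ∈ X, x₁ - y ∉ K := by
    by_contra! hcon
    obtain ⟨a, ha, b, hb, hab⟩ := hne
    exact hab (by simpa using K.sub_mem (hcon b hb) (hcon a ha))
  have hlt := hpair _ h1 _ hy hxy
  by_cases hbig : #(elems K) < #(X.filter fun z => z - x₁ ∈ K) + #(X.filter fun z => z - x₁ ∈ K)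
  · have := add_mem_add (add_mem_add_self_of_card_lt (K.sub_mem hh h12) hbig) h3
    convert this using 1; abel
  have hbig' : #(elems K) < #(X.filter fun z => z - y ∈ K) + #(X.filter fun z => z - y ∈ K) := by
    omega
  rcases hexp with e2 | e3
  · have hk : h - (x₁ - x₂) ∈ K := K.sub_mem hh h12
    have := add_mem_add (add_mem_add_self_of_card_lt hk hbig') h3
    have e : h + (x₁ + x₂ + x₃) = y + y + (h - (x₁ - x₂)) + x₃ + (x₁ + x₁) - (y + y) := by abel
    rw [e, e2 x₁, add_zero, e2 y, sub_zero, ← e2 y]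
    exact this
  · have hk : h - (x₁ - x₂) - (x₁ - x₃) ∈ K := K.sub_mem (K.sub_mem hh h12) h13
    have := add_mem_add (add_mem_add_self_of_card_lt hk hbig') hy
    have e : h + (x₁ + x₂ + x₃) = y + y + (h - (x₁ - x₂) - (x₁ - x₃)) + y + (x₁ + x₁ + x₁) -
      (y + y + y) := by abel
    rw [e, e3, e3]
    simpa using this

/-- The `k`-fold sumset of `X`. -/
noncomputable def iter (X : Finset G) : ℕ → Finset G
  | 0 => 0
  | k + 1 => iter X k + X

lemma iter_add (X : Finset G) (j k : ℕ) : iter X (j + k) = iter X j + iter X k := by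
  induction k with
  | zero => simp [iter]
  | succ k ih => rw [← add_assoc, iter, ih, iter, add_assoc]

lemma iter_one (X : Finset G) : iter X 1 = X := by simp [iter]

lemma iter_nonempty {X : Finset G} (h : X.Nonempty) (k : ℕ) : (iter X k).Nonempty := by
  induction k with
  | zero => simp [iter]
  | succ k ih => exact ih.add h

lemma Aperiodic.left {A B : Finset G} (h : Aperiodic (A + B)) : Aperiodic A := by
  rw [aperiodic_iff] at *
  rw [eq_bot_iff, ← h]
  exact stab_le_stab_add A B

lemma IsPeriodic.add_right {K : AddSubgroup G} {A : Finset G} (h : IsPeriodic K A)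
    (B : Finset G) : IsPeriodic K (A + B) := fun _ hg =>
  mem_stab.1 (stab_le_stab_add A B (h.le_stab hg))

lemma Aperiodic.ne_univ {A : Finset G} (h : Aperiodic A) (hG : 2 ≤ Fintype.card G) :
    A ≠ univ := by
  rintro rfl
  obtain ⟨a, b, hab⟩ := Fintype.exists_pair_of_one_lt_card (α := G) (by omega)
  exact hab (sub_eq_zero.1 (h (a - b) fun c _ => mem_univ _))

lemma card_iter_of_generates {X : Finset G} {k : ℕ}
    (hexp : (∀ g : G, g + g = 0) ∨ ∀ g : G, g + g + g = 0) (hX2 : 2 ≤ #X) (hk : 3 ≤ k)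
    (hap : Aperiodic (iter X k))
    (hgen : ∀ L : AddSubgroup G, (∀ a ∈ X, ∀ b ∈ X, a - b ∈ L) → L = ⊤) :
    k * #X ≤ #(iter X k) + 1 := by
  have hXn : X.Nonempty := card_pos.1 (by omega)
  have hfree : HoleFree X := by
    intro K hKb hKt
    by_contra! hlt
    have h3 := isPeriodic_add_add_self hexp hlt (by
      by_contra! h
      exact hKt (hgen K h))
    apply hKb
    refine hap.eq_bot ?_
    obtain ⟨j, rfl⟩ := Nat.exists_eq_add_of_le hk
    rw [iter_add]
    refine IsPeriodic.add_right ?_ _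
    simpa [iter] using h3
  have hapj : ∀ j ≤ k, Aperiodic (iter X j) := by
    intro j hj
    obtain ⟨i, rfl⟩ := Nat.exists_eq_add_of_le hj
    rw [iter_add] at hap
    exact hap.left
  have hinc : ∀ j < k, #(iter X j) + #X ≤ #(iter X (j + 1)) + 1 := fun j hj =>
    kneser_aperiodic (iter_nonempty hXn j) hXn (hapj (j + 1) hj)
  have hG : 2 ≤ Fintype.card G := hX2.trans (card_le_univ X)
  have hkG : #(iter X k) < Fintype.card G := by
    refine lt_of_le_of_ne (card_le_univ _) fun h => ?_
    exact hap.ne_univ hG (card_eq_iff_eq_univ _ |>.1 h)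
  obtain ⟨m, rfl⟩ := Nat.exists_eq_add_of_le' (show 1 ≤ k by omega)
  have hmG : ∀ i j, i + j = m → #(iter X j) + 2 ≤ Fintype.card G := by
    intro i
    induction i with
    | zero =>
      intro j hj
      have := hinc m (by omega)
      obtain rfl : j = m := by omega
      omega
    | succ i ih =>
      intro j hj
      have := hinc j (by omega)
      have := ih (j + 1) (by omega)
      omega
  have hmain : ∀ j, 1 ≤ j → j ≤ m → j * #X ≤ #(iter X j) := by
    intro j hj
    induction j, hj using Nat.le_induction with
    | base => intro _; rw [iter_one, one_mul]
    | succ j hj ih =>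
      intro hjm
      have h1 := ih (by omega)
      have h2 : #X ≤ j * #X := Nat.le_mul_of_pos_left _ hj
      have := hfree.card_add_card_le_card_add hX2 hexp (A := iter X j) (by omega)
        (hmG (m - (j + 1)) (j + 1) (by omega))
      rw [add_one_mul, iter]
      omega
  have h1 := hmain m (by omega) le_rfl
  have h2 := hinc m (by omega)
  rw [add_one_mul]
  omega

lemma iter_image {M : Type u} [AddCommGroup M] [Fintype M] (φ : M →+ G) (X : Finset M) (k : ℕ) :
    (iter X k).image φ = iter (X.image φ) k := by
  induction k with
  | zero => simp [iter]; rfl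
  | succ k ih => rw [iter, iter, image_add, ih]

lemma iter_singleton_add (g : G) (X : Finset G) (k : ℕ) :
    iter ({g} + X) k = {k • g} + iter X k := by
  induction k with
  | zero => simp [iter]; rfl
  | succ k ih =>
    rw [iter, iter, ih, add_add_add_comm, singleton_add_singleton, succ_nsmul]

lemma card_iter_ge {X : Finset G} {k : ℕ}
    (hexp : (∀ g : G, g + g = 0) ∨ ∀ g : G, g + g + g = 0) (hX2 : 2 ≤ #X) (hk : 3 ≤ k)
    (hap : Aperiodic (iter X k)) : k * #X ≤ #(iter X k) + 1 := by
  obtain ⟨x₀, hx₀⟩ : X.Nonempty := card_pos.1 (by omega)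
  set S : AddSubgroup G := AddSubgroup.closure {g | ∃ a ∈ X, ∃ b ∈ X, a - b = g} with hS
  obtain ⟨M, _, _, φ, hφ, hr⟩ : ∃ (M : Type u) (_ : AddCommGroup M) (_ : Fintype M) (φ : M →+ G),
      Function.Injective φ ∧ φ.range = S :=
    ⟨S, inferInstance, Fintype.ofFinite _, S.subtype, S.subtype_injective, S.range_subtype⟩
  set Y : Finset M := univ.filter fun m => x₀ + φ m ∈ X with hY
  have hXY : X = {x₀} + Y.image φ := by
    ext x
    rw [mem_singleton_add, mem_image]
    constructor
    · intro hx
      have : x - x₀ ∈ S := AddSubgroup.subset_closure ⟨x, hx, x₀, hx₀, rfl⟩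
      rw [← hr] at this
      obtain ⟨m, hm⟩ := this
      exact ⟨m, by simpa [hY, hm] using hx, hm⟩
    · rintro ⟨m, hm, he⟩
      simp only [hY, mem_filter, mem_univ, true_and, he] at hm
      simpa using hm
  have hcardY : #X = #Y := by
    conv_lhs => rw [hXY]
    rw [card_singleton_add, card_image_of_injective _ hφ]
  have hit : iter X k = {k • x₀} + (iter Y k).image φ := by
    conv_lhs => rw [hXY]
    rw [iter_singleton_add, iter_image]
  have hcard : #(iter X k) = #(iter Y k) := by
    rw [hit, card_singleton_add, card_image_of_injective _ hφ]
  rw [hcard, hcardY]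
  refine card_iter_of_generates ?_ (hcardY ▸ hX2) hk ?_ ?_
  · refine hexp.imp (fun h g => hφ ?_) fun h g => hφ ?_
    · simp [h]
    · simp [h]
  · intro g hg
    apply hφ
    rw [map_zero]
    refine hap _ fun c hc => ?_
    rw [hit, mem_singleton_add] at hc ⊢
    obtain ⟨y, hy, he⟩ := mem_image.1 hc
    refine mem_image.2 ⟨g + y, hg y hy, ?_⟩
    rw [map_add, he]; abel
  · intro L hL
    rw [eq_top_iff]
    have hSL : S ≤ L.map φ := by
      rw [hS, AddSubgroup.closure_le]
      rintro _ ⟨a, ha, b, hb, rfl⟩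
      rw [hXY, mem_singleton_add] at ha hb
      obtain ⟨m, hm, hme⟩ := mem_image.1 ha
      obtain ⟨m', hm', hme'⟩ := mem_image.1 hb
      refine ⟨m - m', hL m hm m' hm', ?_⟩
      simp [hme, hme']
    intro m _
    have : φ m ∈ S := by rw [← hr]; exact ⟨m, rfl⟩
    obtain ⟨l, hl, he⟩ := hSL this
    rw [← hφ he]; exact hl

section sums
variable {ι : Type*}

/-- The values taken at least `n` times by `f` on `s`. -/
noncomputable def heavy (s : Finset ι) (n : ℕ) (f : ι → G) : Finset G :=
  univ.filter fun q => n ≤ #(s.filter fun i => f i = q)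

lemma card_filter_notMem_eq_sum (s : Finset ι) (f : ι → G) (X : Finset G) :
    #(s.filter fun i => f i ∉ X) = ∑ q ∈ Xᶜ, #(s.filter fun i => f i = q) := by
  rw [card_eq_sum_card_fiberwise (f := f) (t := Xᶜ)
    (fun i hi => by simpa using (mem_filter.1 hi).2)]
  refine sum_congr rfl fun q hq => ?_
  congr 1
  ext i
  simp only [mem_filter, and_congr_left_iff, and_iff_left_iff_imp]
  rintro rfl _
  simpa using hq

lemma card_eq_sum_heavy_add (s : Finset ι) (f : ι → G) (X : Finset G) :
    #s = ∑ q ∈ X, #(s.filter fun i => f i = q) + #(s.filter fun i => f i ∉ X) := by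
  rw [card_filter_notMem_eq_sum, sum_add_sum_compl]
  exact card_eq_sum_card_fiberwise (fun i _ => mem_coe.2 (mem_univ _))

lemma clos_bot (A : Finset G) : clos ⊥ A = A := by
  ext x; simp [mem_clos, sub_eq_zero]

lemma cnt_bot (s : Finset ι) (f : ι → G) (q : G) :
    cnt s f ⊥ q = #(s.filter fun i => f i = q) := by
  simp [cnt, sub_eq_zero]

lemma sum_min_le_card_sums {s : Finset ι} {n : ℕ} {f : ι → G} (hn : n ≤ #s)
    (hap : Aperiodic (sums s n f)) :
    ∑ q, min n #(s.filter fun i => f i = q) + 1 ≤ #(sums s n f) + n := by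
  have := sumsBound s f n hn ⊥
  rw [SumsBound, clos_bot, card_elems_bot, mul_one] at this
  simpa only [cnt_bot] using this (aperiodic_iff.1 hap)

lemma card_heavy_mul_add_le {s : Finset ι} {m n : ℕ} {f : ι → G} (hm : m ≤ #s) (hmn : m ≤ n)
    (he : m = n ∨ #(s.filter fun i => f i ∉ heavy s n f) ≤ m) (hap : Aperiodic (sums s m f)) :
    #(heavy s n f) * m + #(s.filter fun i => f i ∉ heavy s n f) + 1 ≤ #(sums s m f) + m := by
  have h := sum_min_le_card_sums hm hap
  rw [← sum_add_sum_compl (heavy s n f)] at h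
  have h1 : ∑ q ∈ heavy s n f, min m #(s.filter fun i => f i = q) = #(heavy s n f) * m := by
    rw [sum_congr rfl (g := fun _ => m), sum_const, smul_eq_mul]
    intro q hq
    exact min_eq_left (hmn.trans (mem_filter.1 hq).2)
  have h2 : ∑ q ∈ (heavy s n f)ᶜ, min m #(s.filter fun i => f i = q) =
      #(s.filter fun i => f i ∉ heavy s n f) := by
    rw [card_filter_notMem_eq_sum]
    refine sum_congr rfl fun q hq => min_eq_right ?_
    rw [mem_compl] at hq
    rcases he with rfl | he
    · simp only [heavy, mem_filter, mem_univ, true_and] at hq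
      omega
    · refine le_trans (card_le_card fun i hi => ?_) he
      rw [mem_filter] at *
      exact ⟨hi.1, by rw [hi.2]; exact hq⟩
  omega

lemma sum_mem_iter {X : Finset G} {f : ι → G} (J : Finset ι) (h : ∀ i ∈ J, f i ∈ X) :
    ∑ i ∈ J, f i ∈ iter X #J := by
  induction J using Finset.induction_on with
  | empty => simp [iter]
  | insert a J ha ih =>
    rw [sum_insert ha, card_insert_of_notMem ha, iter, add_comm (f a)]
    exact add_mem_add (ih fun i hi => h i (mem_insert_of_mem hi)) (h a (mem_insert_self _ _))

lemma sums_add_heavy_subset {s : Finset ι} {m n : ℕ} {f : ι → G} (h : m < n) :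
    sums s m f + heavy s n f ⊆ sums s (m + 1) f := by
  intro x hx
  obtain ⟨y, hy, q, hq, rfl⟩ := mem_add.1 hx
  obtain ⟨I, hI, hc, rfl⟩ := mem_sums.1 hy
  have hq' := (mem_filter.1 hq).2
  obtain ⟨i, hi, hiI⟩ : ∃ i ∈ s.filter (fun i => f i = q), i ∉ I := by
    by_contra! hcon
    have := card_le_card (show s.filter (fun i => f i = q) ⊆ I from hcon)
    omega
  obtain ⟨his, rfl⟩ := mem_filter.1 hi
  exact mem_sums.2 ⟨insert i I, insert_subset his hI, by rw [card_insert_of_notMem hiI, hc],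
    by rw [sum_insert hiI, add_comm]⟩

lemma sums_add_iter_heavy_subset {s : Finset ι} {m n k : ℕ} {f : ι → G} (h : m + k ≤ n) :
    sums s m f + iter (heavy s n f) k ⊆ sums s (m + k) f := by
  induction k with
  | zero => simp [iter]
  | succ k ih =>
    rw [iter, ← add_assoc, ← add_assoc]
    exact (add_subset_add_right (ih (by omega))).trans (sums_add_heavy_subset (by omega))

lemma sums_eq_add_iter_heavy {s : Finset ι} {n k : ℕ} {f : ι → G}
    (h : #(s.filter fun i => f i ∉ heavy s n f) + k = n) :
    sums s n f = sums s #(s.filter fun i => f i ∉ heavy s n f) f + iter (heavy s n f) k := by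
  refine subset_antisymm ?_ ?_
  swap
  · conv_rhs => rw [← h]
    exact sums_add_iter_heavy_subset h.le
  intro x hx
  obtain ⟨I, hI, hc, rfl⟩ := mem_sums.1 hx
  have h1 := card_filter_add_card_filter_not (s := I) (fun i => f i ∈ heavy s n f)
  have h2 := card_le_card (filter_subset_filter (fun i => f i ∉ heavy s n f) hI)
  obtain ⟨J, hJ, rfl⟩ := exists_subset_card_eq
    (show k ≤ #(I.filter fun i => f i ∈ heavy s n f) by omega)
  have hJI : J ⊆ I := hJ.trans (filter_subset _ _)
  rw [← sum_sdiff hJI]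
  refine add_mem_add (mem_sums.2 ⟨_, sdiff_subset.trans hI, ?_, rfl⟩)
    (sum_mem_iter J fun i hi => (mem_filter.1 (hJ hi)).2)
  rw [card_sdiff_of_subset hJI]
  omega

lemma card_heavy_mul_le {s : Finset ι} {n k : ℕ} {f : ι → G}
    (hexp : (∀ g : G, g + g = 0) ∨ ∀ g : G, g + g + g = 0) (hn : n ≤ #s)
    (hX2 : 2 ≤ #(heavy s n f)) (h : #(s.filter fun i => f i ∉ heavy s n f) + k = n) (hk : 3 ≤ k)
    (hap : Aperiodic (sums s n f)) : #(heavy s n f) * n ≤ #(sums s n f) + 1 := by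
  have heq := sums_eq_add_iter_heavy h
  have hap' := heq ▸ hap
  have h1 := card_heavy_mul_add_le (by omega) (by omega) (Or.inr le_rfl) hap'.left
  have h2 := card_iter_ge hexp hX2 hk (by rw [add_comm] at hap'; exact hap'.left)
  have h3 := kneser_aperiodic (sums_nonempty f (by omega))
    (iter_nonempty (card_pos.1 (by omega)) k) hap'
  rw [← heq] at h3
  have h4 : #(heavy s n f) * n = #(heavy s n f) * #(s.filter fun i => f i ∉ heavy s n f) +
    k * #(heavy s n f) := by rw [mul_comm k, ← mul_add, h]
  omega

lemma sums_image {M : Type u} [AddCommGroup M] [Fintype M] (φ : G →+ M) (s : Finset ι) (n : ℕ)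
    (f : ι → G) : (sums s n f).image φ = sums s n fun i => φ (f i) := by
  simp only [sums, image_image]
  refine image_congr fun I _ => ?_
  simp

theorem sums_eq_univ (hexp : (∀ g : G, g + g = 0) ∨ ∀ g : G, g + g + g = 0) (s : Finset ι)
    (f : ι → G) {n : ℕ} (hlen : n + Fintype.card G ≤ #s + 1)
    (hmult : ∀ x, #(s.filter fun i => f i = x) ≤ n)
    (hcoset : ∀ H : AddSubgroup G, H ≠ ⊤ → ∀ α : G,
      Nat.card (G ⧸ H) ≤ #(s.filter fun i => f i - α ∉ H) + 1) : sums s n f = univ := by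
  by_contra hne
  set H := stab (sums s n f) with hH
  have hper : IsPeriodic H (sums s n f) := isPeriodic_stab _
  have hGpos : 0 < Fintype.card G := Fintype.card_pos
  have hns : n ≤ #s := by omega
  obtain ⟨z₀, hz₀⟩ := sums_nonempty f hns
  have hHtop : H ≠ ⊤ := by
    intro ht
    refine hne (eq_univ_iff_forall.2 fun x => ?_)
    have := hper (x - z₀) (ht ▸ AddSubgroup.mem_top _) z₀ hz₀
    simpa using this
  obtain ⟨Q, _, _, φ, hφ, hker, hcardQ, hcard⟩ : ∃ (Q : Type u) (_ : AddCommGroup Q)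
      (_ : Fintype Q) (φ : G →+ Q), Function.Surjective φ ∧ (∀ g, φ g = 0 ↔ g ∈ H) ∧
      Nat.card (G ⧸ H) = Fintype.card Q ∧ Fintype.card Q * #(elems H) = Fintype.card G := by
    refine ⟨G ⧸ H, inferInstance, inferInstance, QuotientAddGroup.mk' H,
      QuotientAddGroup.mk'_surjective H, fun g => by simp, Nat.card_eq_fintype_card, ?_⟩
    have h := AddSubgroup.card_eq_card_quotient_mul_card_addSubgroup H
    rw [← Nat.card_eq_fintype_card, ← Nat.card_eq_fintype_card, h]
    congr 1
    simp [elems, Nat.card_eq_fintype_card, Fintype.card_subtype]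
  have hsub : ∀ x y, φ x = φ y ↔ x - y ∈ H := fun x y => by
    rw [← hker, map_sub, sub_eq_zero]
  set F : ι → Q := fun i => φ (f i) with hF
  have himg : (sums s n f).image φ = sums s n F := sums_image φ s n f
  have hap : Aperiodic (sums s n F) := by
    intro q hq
    obtain ⟨g, rfl⟩ := hφ q
    rw [hker, hH, mem_stab]
    intro c hc
    rw [← himg] at hq
    obtain ⟨c', hc', he⟩ := mem_image.1 (hq _ (mem_image_of_mem φ hc))
    rw [← map_add, eq_comm, hsub] at he
    simpa using hper _ he _ hc'
  have hltQ : #(sums s n F) < Fintype.card Q := by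
    refine lt_of_le_of_ne (card_le_univ _) fun h => hne ?_
    have hu := (card_eq_iff_eq_univ _).1 h
    refine eq_univ_iff_forall.2 fun x => ?_
    obtain ⟨c, hc, he⟩ := mem_image.1 (show φ x ∈ (sums s n f).image φ by
      rw [himg, hu]; exact mem_univ _)
    rw [eq_comm, hsub] at he
    simpa using hper _ he _ hc
  set X := heavy s n F with hX
  set e := #(s.filter fun i => F i ∉ X) with he
  have hi := card_heavy_mul_add_le (f := F) hns le_rfl (Or.inl rfl) hap
  rw [← hX, ← he] at hi
  have hfib : ∀ q, #(s.filter fun i => F i = q) ≤ n * #(elems H) := by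
    intro q
    obtain ⟨g, rfl⟩ := hφ q
    have hmaps : ∀ i ∈ s.filter (fun i => F i = φ g), f i ∈ (elems H).image fun h => h + g := by
      intro i hi
      refine mem_image.2 ⟨f i - g, mem_elems.2 ((hsub _ _).1 (mem_filter.1 hi).2), by simp⟩
    refine (card_le_mul_card_image_of_maps_to hmaps n fun b _ => ?_).trans
      (Nat.mul_le_mul_left _ card_image_le)
    exact (card_le_card (filter_subset_filter _ (filter_subset _ _))).trans (hmult b)
  have hsle : #s ≤ #X * (n * #(elems H)) + e := by
    rw [card_eq_sum_heavy_add s F X]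
    exact Nat.add_le_add_right (sum_le_card_nsmul _ _ _ fun q _ => hfib q) _
  have hpos := card_elems_pos H
  rw [← hcard] at hlen
  set h := #(elems H)
  set N := #X with hN
  set c := Fintype.card Q
  have hN0 : N ≠ 0 := by
    intro h0
    rw [h0] at hi hsle
    have := Nat.le_mul_of_pos_right c hpos
    omega
  have hN1 : N ≠ 1 := by
    intro h1
    obtain ⟨x, hx⟩ := card_eq_one.1 (hN ▸ h1)
    obtain ⟨g, rfl⟩ := hφ x
    have := hcoset H hHtop g
    have heq : #(s.filter fun i => f i - g ∉ H) = e := by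
      rw [he, hx]
      simp only [mem_singleton, hF, hsub]
    rw [h1] at hi
    omega
  obtain ⟨d, hd⟩ := Nat.exists_eq_add_of_le hpos
  have hd' : h = d + 1 := by omega
  rw [hd'] at hlen hsle
  have hlt : d * c < d * (N * n) := by linarith
  have hc : c < N * n := lt_of_mul_lt_mul_left hlt (Nat.zero_le d)
  have hen : e + 3 ≤ n := by omega
  have hN2 : 2 ≤ N := by omega
  have hek : e + (n - e) = n := by omega
  have hfin : N * n ≤ #(sums s n F) + 1 := by
    refine card_heavy_mul_le (hexp.imp (fun h2 q => ?_) fun h3 q => ?_) hns hN2 hek (by omega) hap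
    · obtain ⟨g, rfl⟩ := hφ q
      rw [← map_add, h2, map_zero]
    · obtain ⟨g, rfl⟩ := hφ q
      rw [← map_add, ← map_add, h3, map_zero]
  omega

end sums

end SeqSum

open scoped Pointwise Classical in
theorem stmt_14 {G : Type*} [AddCommGroup G] [Fintype G]
    (hexp : AddMonoid.exponent G ≤ 3)
    (n : ℕ) (hn : 1 ≤ n)
    (S : Multiset G)
    (hlen : n + Nat.card G - 1 ≤ Multiset.card S)
    (hmult : ∀ x : G, S.count x ≤ n)
    (hcoset : ∀ H : AddSubgroup G, H ≠ ⊤ → ∀ α : G,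
      Nat.card (G ⧸ H) - 1 ≤
        Multiset.card (S.filter fun x => x ∉ α +ᵥ (H : Set G))) :
    subseqSums S n = Set.univ := by
  classical
  have hexp' : (∀ g : G, g + g = 0) ∨ ∀ g : G, g + g + g = 0 := by
    have h0 : AddMonoid.exponent G ≠ 0 := AddMonoid.exponent_ne_zero_of_finite
    have h := AddMonoid.exponent_nsmul_eq_zero (G := G)
    generalize AddMonoid.exponent G = m at hexp h0 h
    interval_cases m
    · omega
    · exact Or.inl fun g => by simpa using congrArg₂ (· + ·) (h g) (h g)
    · exact Or.inl fun g => by rw [← two_nsmul, h]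
    · exact Or.inr fun g => by rw [← h g]; abel
  obtain ⟨k, f, rfl⟩ : ∃ (k : ℕ) (f : Fin k → G), S = Finset.univ.val.map f := by
    induction S using Quotient.inductionOn with
    | h l => exact ⟨l.length, l.get, by simp⟩
  have hpos : 0 < Nat.card G := Nat.card_pos
  have hu := SeqSum.sums_eq_univ hexp' Finset.univ f (n := n) ?_ ?_ ?_
  · refine Set.eq_univ_of_forall fun x => ?_
    obtain ⟨I, hI, hc, hs⟩ := SeqSum.mem_sums.1 (hu ▸ Finset.mem_univ x)
    exact ⟨I.val.map f, Multiset.map_le_map (Finset.val_le_iff.2 hI), by simpa using hc, hs⟩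
  · rw [← Nat.card_eq_fintype_card]
    simp only [Multiset.card_map, Finset.card_val] at hlen
    omega
  · intro x
    have := hmult x
    rw [Multiset.count_map] at this
    simpa only [eq_comm, Finset.card_def, Finset.filter_val] using this
  · intro H hH α
    have := hcoset H hH α
    rw [Multiset.filter_map, Multiset.card_map] at this
    have he : (Finset.univ.filter fun i => f i - α ∉ H).card =
        Multiset.card (Finset.univ.val.filter ((fun x => x ∉ α +ᵥ (H : Set G)) ∘ f)) := by
      rw [Finset.card_def, Finset.filter_val]
      congr 2
      funext i
      simp [Set.mem_vadd_set_iff_neg_vadd_mem, sub_eq_neg_add]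
    omega
end

section
/- Let G be a finite cyclic group with smallest prime divisor p of |G|, let n ≥ |G|/p − 1, and let S be a finite sequence over G with |S| ≥ n + |G| − 1 and h(S) ≤ n. Suppose that for every proper subgroup H < G and every α ∈ G, at least |G/H| − 1 terms of S lie outside α + H. Then Σ_n(S) = G. -/
section SubsequenceSums

open Finset
open scoped Pointwise Classical

variable {G : Type*} [AddCommGroup G]

/-- The stabilizer of a finite set under translation. -/
def Finset.translationStab (X : Finset G) : AddSubgroup G where
  carrier := {g | ∀ x, g + x ∈ X ↔ x ∈ X}
  zero_mem' := by simp
  add_mem' := by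
    intro a b ha hb x
    rw [add_assoc, ha, hb]
  neg_mem' := by
    intro a ha x
    rw [← ha (-a + x), add_neg_cancel_left]

theorem Finset.mem_translationStab {X : Finset G} {g : G} :
    g ∈ X.translationStab ↔ ∀ x, g + x ∈ X ↔ x ∈ X := Iff.rfl

theorem Finset.mem_translationStab_of_forall_mem {X : Finset G} {g : G}
    (h : ∀ x ∈ X, g + x ∈ X) : g ∈ X.translationStab := by
  have hX : X.image (g + ·) = X := by
    apply Finset.eq_of_subset_of_card_le
    · intro y hy
      obtain ⟨x, hx, rfl⟩ := Finset.mem_image.1 hy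
      exact h x hx
    · rw [Finset.card_image_of_injective _ (add_right_injective g)]
  intro x
  refine ⟨fun hx => ?_, h x⟩
  rw [← hX] at hx
  obtain ⟨y, hy, hyx⟩ := Finset.mem_image.1 hx
  rwa [← add_left_cancel hyx]

theorem AddSubgroup.le_translationStab {K : AddSubgroup G} {X : Finset G}
    (h : ∀ k ∈ K, ∀ x ∈ X, k + x ∈ X) : K ≤ X.translationStab :=
  fun k hk => Finset.mem_translationStab_of_forall_mem (h k hk)

/-- The number of terms of `S` in the coset `g + K`. -/
noncomputable def cosetCount (K : AddSubgroup G) (g : G) (S : Multiset G) : ℕ :=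
  S.countP (fun s => s - g ∈ K)

theorem cosetCount_le_card (K : AddSubgroup G) (g : G) (S : Multiset G) :
    cosetCount K g S ≤ Multiset.card S := Multiset.countP_le_card _ _

theorem cosetCount_mono {K L : AddSubgroup G} (h : K ≤ L) (g : G) (S : Multiset G) :
    cosetCount K g S ≤ cosetCount L g S := by
  rw [cosetCount, cosetCount, Multiset.countP_eq_card_filter, Multiset.countP_eq_card_filter]
  exact Multiset.card_le_card (Multiset.monotone_filter_right _ fun _ hs => h hs)

theorem cosetCount_le_of_le {S T : Multiset G} (h : T ≤ S) (K : AddSubgroup G) (g : G) :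
    cosetCount K g T ≤ cosetCount K g S := Multiset.countP_le_of_le _ h

theorem cosetCount_congr {K : AddSubgroup G} {g g' : G} (h : g - g' ∈ K) (S : Multiset G) :
    cosetCount K g S = cosetCount K g' S := by
  refine Multiset.countP_congr rfl fun s _ => ?_
  rw [← K.add_mem_cancel_right h (y := s - g), sub_add_sub_cancel]

/-- The terms of `S` in the coset `q`. -/
noncomputable def cosetPart (K : AddSubgroup G) (q : G ⧸ K) (S : Multiset G) : Multiset G :=
  S.filter fun s => (s : G ⧸ K) = q

theorem card_cosetPart (K : AddSubgroup G) (g : G) (S : Multiset G) :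
    Multiset.card (cosetPart K (g : G ⧸ K) S) = cosetCount K g S := by
  rw [cosetPart, cosetCount, Multiset.countP_eq_card_filter]
  congr 1
  exact Multiset.filter_congr fun s _ => QuotientAddGroup.eq_iff_sub_mem

theorem cosetCount_cosetPart {K L : AddSubgroup G} (h : L ≤ K) (g : G) (q : G ⧸ K)
    (S : Multiset G) :
    cosetCount L g (cosetPart K q S) = if (g : G ⧸ K) = q then cosetCount L g S else 0 := by
  rw [cosetCount, cosetPart, Multiset.countP_filter]
  split_ifs with hg
  · subst hg
    refine Multiset.countP_congr rfl fun s _ => ?_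
    rw [QuotientAddGroup.eq_iff_sub_mem]
    simpa using fun hs => h hs
  · rw [Multiset.countP_eq_zero]
    rintro s _ ⟨hs, rfl⟩
    exact hg (QuotientAddGroup.eq_iff_sub_mem.2 (h (neg_sub s g ▸ neg_mem hs)))

theorem mk_sum_cosetPart (K : AddSubgroup G) (q : G ⧸ K) {S T : Multiset G}
    (h : T ≤ cosetPart K q S) : ((T.sum : G) : G ⧸ K) = Multiset.card T • q := by
  rw [← QuotientAddGroup.mk'_apply, map_multiset_sum, Multiset.map_congr rfl (g := fun _ => q),
    Multiset.map_const', Multiset.sum_replicate]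
  intro x hx
  exact (Multiset.mem_filter.1 (Multiset.mem_of_le h hx)).2

theorem sum_cosetPart (K : AddSubgroup G) [Fintype (G ⧸ K)] (S : Multiset G) :
    ∑ q : G ⧸ K, cosetPart K q S = S := by
  ext x
  rw [Multiset.count_sum']
  simp [cosetPart, Multiset.count_filter]

/-- The stabilizer of a `K`-periodic set extended by part of a single further `K`-coset. -/
theorem translationStab_union {C D : Finset G} {y z : G}
    (hD : ∀ d ∈ D, d - y ∈ C.translationStab) (hy : y ∈ D) (hz : z ∉ D)
    (hzy : z - y ∈ C.translationStab) (hyC : y ∉ C) :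
    (C ∪ D).translationStab = D.translationStab := by
  have hDC : ∀ d, d - y ∈ C.translationStab → d ∉ C := fun d hd hdC =>
    hyC (by have := (hd y).1 (by rwa [sub_add_cancel]); exact this)
  have hle : D.translationStab ≤ C.translationStab := fun g hg => by
    have := hD _ ((hg y).2 hy)
    rwa [add_sub_cancel_right] at this
  refine le_antisymm (fun g hg => ?_) (fun g hg x => ?_)
  · have hgC : g ∈ C.translationStab := by
      by_contra hgC
      have h₁ := (hg y).2 (Finset.mem_union_right _ hy)
      have h₂ : g + y ∉ D := fun h => hgC (by have := hD _ h; rwa [add_sub_cancel_right] at this)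
      have h₃ := (Finset.mem_union.1 h₁).resolve_right h₂
      have h₄ := (hzy (g + y)).2 h₃
      rw [show z - y + (g + y) = g + z by abel] at h₄
      rcases Finset.mem_union.1 ((hg z).1 (Finset.mem_union_left _ h₄)) with h | h
      · exact hDC z hzy h
      · exact hz h
    apply Finset.mem_translationStab_of_forall_mem
    intro d hd
    refine (Finset.mem_union.1 ((hg d).2 (Finset.mem_union_right _ hd))).resolve_left ?_
    exact (hgC d).not.2 (hDC d (hD d hd))
  · rw [Finset.mem_union, Finset.mem_union, hg x, hle hg x]

theorem cosetCount_sub_add {S T : Multiset G} (h : T ≤ S) (K : AddSubgroup G) (g : G) :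
    cosetCount K g (S - T) + cosetCount K g T = cosetCount K g S := by
  rw [cosetCount, cosetCount, ← Multiset.countP_add, tsub_add_cancel_of_le h, cosetCount]

variable [Fintype G]

theorem AddSubgroup.card_filter_sub_mem (K : AddSubgroup G) (c : G) :
    #{g : G | g - c ∈ K} = Nat.card K := by
  rw [← Fintype.card_subtype, ← Nat.card_eq_fintype_card]
  exact Nat.card_congr ((Equiv.subRight c).subtypeEquiv fun _ => by simp)

theorem AddSubgroup.card_filter_sub_mem' (K : AddSubgroup G) (c : G) :
    #{g : G | c - g ∈ K} = Nat.card K := by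
  rw [← K.card_filter_sub_mem c]
  congr 1
  ext g
  simp only [Finset.mem_filter, Finset.mem_univ, true_and]
  rw [← neg_mem_iff, neg_sub]

theorem AddSubgroup.card_le_card_of_add_mem {K : AddSubgroup G} {X : Finset G}
    (hX : X.Nonempty) (h : ∀ k ∈ K, ∀ x ∈ X, k + x ∈ X) : Nat.card K ≤ #X := by
  obtain ⟨c, hc⟩ := hX
  rw [← K.card_filter_sub_mem c]
  apply Finset.card_le_card
  intro g hg
  rw [← sub_add_cancel g c]
  exact h _ (Finset.mem_filter.1 hg).2 c hc

/-- Counting the sums `x + y - c`, with `x` and `y` in cosets of `H₁` and `H₂` through `c`. -/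
theorem card_mul_card_le_of_sub_mem {H₁ H₂ : AddSubgroup G} {c : G} {X Y Z : Finset G}
    (hX : ∀ x ∈ X, x - c ∈ H₁) (hY : ∀ y ∈ Y, y - c ∈ H₂)
    (hZ : ∀ x ∈ X, ∀ y ∈ Y, x + y - c ∈ Z) :
    #X * #Y ≤ Nat.card (H₁ ⊓ H₂ : AddSubgroup G) * #Z := by
  rw [← Finset.card_product]
  refine Finset.card_le_mul_card_image_of_maps_to (f := fun q : G × G => q.1 + q.2 - c)
    (fun q hq => hZ _ (Finset.mem_product.1 hq).1 _ (Finset.mem_product.1 hq).2) _ ?_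
  intro z _
  rcases Finset.eq_empty_or_nonempty {q ∈ X ×ˢ Y | q.1 + q.2 - c = z} with h | ⟨q₀, hq₀⟩
  · rw [h]; simp
  rw [← (H₁ ⊓ H₂).card_filter_sub_mem q₀.1]
  simp only [Finset.mem_filter, Finset.mem_product] at hq₀
  refine Finset.card_le_card_of_injOn Prod.fst ?_ ?_
  · intro q hq
    simp only [Finset.coe_filter, Finset.mem_product, Set.mem_ofPred_eq] at hq
    simp only [Finset.coe_filter, Finset.mem_univ, true_and, Set.mem_ofPred_eq,
      AddSubgroup.mem_inf]
    constructor
    · have := sub_mem (hX _ hq.1.1) (hX _ hq₀.1.1)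
      rwa [sub_sub_sub_cancel_right] at this
    · have := sub_mem (hY _ hq₀.1.2) (hY _ hq.1.2)
      rw [sub_sub_sub_cancel_right] at this
      have e : q.1 - q₀.1 = q₀.2 - q.2 := by
        rw [sub_eq_sub_iff_add_eq_add, add_comm q₀.2]
        exact sub_left_injective (hq.2.trans hq₀.2.symm)
      rwa [e]
  · intro q hq q' hq' h
    simp only [Finset.coe_filter, Set.mem_ofPred_eq] at hq hq'
    have := sub_left_injective (hq.2.trans hq'.2.symm)
    exact Prod.ext h (add_left_cancel (h ▸ this))

theorem card_lt_of_mem_sdiff {C₁ C₂ : Finset G} {c : G} (hc₂ : c ∈ C₂) (hc₁ : c ∉ C₁)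
    (h₁ : #(C₂ \ C₁) + Nat.card (C₁.translationStab ⊓ C₂.translationStab : AddSubgroup G)
      < Nat.card C₁.translationStab)
    (h₂ : #(C₁ \ C₂) + Nat.card (C₁.translationStab ⊓ C₂.translationStab : AddSubgroup G)
      < Nat.card C₂.translationStab) :
    Nat.card C₂.translationStab < Nat.card C₁.translationStab := by
  set H₁ := C₁.translationStab with hH₁
  set H₂ := C₂.translationStab with hH₂
  set m := Nat.card (H₁ ⊓ H₂ : AddSubgroup G) with hm
  set P : Finset G := {g | g - c ∈ H₁ ∧ g ∈ C₂} with hP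
  set P' : Finset G := {g | g - c ∈ H₁ ∧ g ∉ C₂} with hP'
  set Q : Finset G := {g | g - c ∈ H₂ ∧ g ∉ C₁} with hQ
  set Q' : Finset G := {g | g - c ∈ H₂ ∧ g ∈ C₁} with hQ'
  have mem₁ : ∀ {g x}, g ∈ H₁ → (g + x ∈ C₁ ↔ x ∈ C₁) := fun hg => hg _
  have mem₂ : ∀ {g x}, g ∈ H₂ → (g + x ∈ C₂ ↔ x ∈ C₂) := fun hg => hg _
  have cardP : #P + #P' = Nat.card H₁ := by
    rw [← H₁.card_filter_sub_mem c, hP, hP', ← Finset.filter_filter, ← Finset.filter_filter]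
    exact Finset.card_filter_add_card_filter_not _
  have cardQ : #Q' + #Q = Nat.card H₂ := by
    rw [← H₂.card_filter_sub_mem c, hQ, hQ', ← Finset.filter_filter, ← Finset.filter_filter]
    exact Finset.card_filter_add_card_filter_not _
  have le_card : ∀ {X : Finset G}, X.Nonempty →
      (∀ k ∈ H₁, k ∈ H₂ → ∀ x ∈ X, k + x ∈ X) → m ≤ #X := fun hX h =>
    AddSubgroup.card_le_card_of_add_mem hX fun k hk =>
      h k (AddSubgroup.mem_inf.1 hk).1 (AddSubgroup.mem_inf.1 hk).2
  have hPm : m ≤ #P := le_card ⟨c, by simp [hP, hc₂]⟩ fun k k₁ k₂ x hx => by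
    simp only [hP, Finset.mem_filter, Finset.mem_univ, true_and, add_sub_assoc] at hx ⊢
    exact ⟨add_mem k₁ hx.1, (mem₂ k₂).2 hx.2⟩
  have hQm : m ≤ #Q := le_card ⟨c, by simp [hQ, hc₁]⟩ fun k k₁ k₂ x hx => by
    simp only [hQ, Finset.mem_filter, Finset.mem_univ, true_and, add_sub_assoc] at hx ⊢
    exact ⟨add_mem k₂ hx.1, (mem₁ k₁).not.2 hx.2⟩
  have hPm' : P'.Nonempty → m ≤ #P' := fun h => le_card h fun k k₁ k₂ x hx => by
    simp only [hP', Finset.mem_filter, Finset.mem_univ, true_and, add_sub_assoc] at hx ⊢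
    exact ⟨add_mem k₁ hx.1, (mem₂ k₂).not.2 hx.2⟩
  have hQm' : Q'.Nonempty → m ≤ #Q' := fun h => le_card h fun k k₁ k₂ x hx => by
    simp only [hQ', Finset.mem_filter, Finset.mem_univ, true_and, add_sub_assoc] at hx ⊢
    exact ⟨add_mem k₂ hx.1, (mem₁ k₁).2 hx.2⟩
  have hm0 : 0 < m := Nat.card_pos
  have key₁ : #P * #Q ≤ m * #(C₂ \ C₁) := by
    apply card_mul_card_le_of_sub_mem (c := c)
    · intro x hx; exact (Finset.mem_filter.1 hx).2.1
    · intro x hx; exact (Finset.mem_filter.1 hx).2.1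
    · intro x hx y hy
      simp only [hP, hQ, Finset.mem_filter, Finset.mem_univ, true_and] at hx hy
      rw [Finset.mem_sdiff]
      constructor
      · rw [show x + y - c = (y - c) + x by abel, mem₂ hy.1]; exact hx.2
      · rw [show x + y - c = (x - c) + y by abel, mem₁ hx.1]; exact hy.2
  have key₂ : #P' * #Q' ≤ m * #(C₁ \ C₂) := by
    apply card_mul_card_le_of_sub_mem (c := c)
    · intro x hx; exact (Finset.mem_filter.1 hx).2.1
    · intro x hx; exact (Finset.mem_filter.1 hx).2.1
    · intro x hx y hy
      simp only [hP', hQ', Finset.mem_filter, Finset.mem_univ, true_and] at hx hy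
      rw [Finset.mem_sdiff]
      constructor
      · rw [show x + y - c = (x - c) + y by abel, mem₁ hx.1]; exact hy.2
      · rw [show x + y - c = (y - c) + x by abel, mem₂ hy.1]; exact hx.2
  rcases Finset.eq_empty_or_nonempty P' with hp | hp
  · rw [hp, Finset.card_empty, add_zero] at cardP
    rw [cardP] at key₁
    nlinarith
  rcases Finset.eq_empty_or_nonempty Q' with hq | hq
  · rw [hq, Finset.card_empty, zero_add] at cardQ
    rw [cardQ] at key₁
    nlinarith
  exfalso
  have i₁ := hPm' hp
  have i₂ := hQm' hq
  have j₁ : #Q < #P' := by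
    by_contra! hle
    nlinarith [Nat.mul_le_mul hPm hQm]
  have j₂ : #P' < #Q := by
    by_contra! hle
    nlinarith [Nat.mul_le_mul i₁ i₂]
  omega

/-- Kemperman's bound for the union of two periodic sets. -/
theorem le_card_union_add_card_translationStab {C₁ C₂ : Finset G} {k : ℕ}
    (h₁₂ : ¬ C₁ ⊆ C₂) (h₂₁ : ¬ C₂ ⊆ C₁)
    (h₁ : k ≤ #C₁ + Nat.card C₁.translationStab)
    (h₂ : k ≤ #C₂ + Nat.card C₂.translationStab) :
    k ≤ #(C₁ ∪ C₂) + Nat.card (C₁ ∪ C₂).translationStab := by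
  have hle : Nat.card (C₁.translationStab ⊓ C₂.translationStab : AddSubgroup G)
      ≤ Nat.card (C₁ ∪ C₂).translationStab := by
    refine AddSubgroup.card_le_of_le fun g hg x => ?_
    rw [AddSubgroup.mem_inf] at hg
    rw [Finset.mem_union, Finset.mem_union, hg.1 x, hg.2 x]
  by_contra! hlt
  have c₁ : #(C₁ ∪ C₂) = #(C₂ \ C₁) + #C₁ := by
    rw [Finset.card_sdiff_add_card, Finset.union_comm]
  have c₂ : #(C₁ ∪ C₂) = #(C₁ \ C₂) + #C₂ := by
    rw [Finset.card_sdiff_add_card]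
  obtain ⟨c, hc, hc'⟩ := Finset.not_subset.1 h₂₁
  obtain ⟨d, hd, hd'⟩ := Finset.not_subset.1 h₁₂
  have := card_lt_of_mem_sdiff hc hc' (by omega) (by omega)
  have := card_lt_of_mem_sdiff hd hd' (by rw [inf_comm]; omega) (by rw [inf_comm]; omega)
  omega

theorem exists_mem_subset_add {A B : Finset G} {a b : G} (ha : a ∈ A) (hb : b ∈ B) :
    ∃ C ⊆ A + B, a + b ∈ C ∧ #A + #B ≤ #C + Nat.card C.translationStab := by
  induction hN : #B using Nat.strong_induction_on generalizing A B with
  | _ N ih =>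
  subst hN
  by_cases h : ∀ x ∈ A, ∀ y ∈ B, y - b + x ∈ A
  · refine ⟨A.image (· + b), ?_, Finset.mem_image_of_mem _ ha, ?_⟩
    · intro z hz
      obtain ⟨x, hx, rfl⟩ := Finset.mem_image.1 hz
      exact Finset.add_mem_add hx hb
    · rw [Finset.card_image_of_injective _ (add_left_injective b)]
      gcongr
      rw [← AddSubgroup.card_filter_sub_mem _ b]
      apply Finset.card_le_card
      intro y hy
      simp only [Finset.mem_filter, Finset.mem_univ, true_and]
      apply Finset.mem_translationStab_of_forall_mem
      intro z hz
      obtain ⟨x, hx, rfl⟩ := Finset.mem_image.1 hz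
      rw [← add_assoc]
      exact Finset.mem_image_of_mem (· + b) (h x hx y hy)
  · push Not at h
    obtain ⟨x, hx, y, hy, hxy⟩ := h
    have hcard : #(A ∪ B.image (· + (x - b))) + #{z ∈ B | z + (x - b) ∈ A} = #A + #B := by
      rw [← Finset.card_image_of_injective B (add_left_injective (x - b)),
        ← Finset.card_union_add_card_inter A]
      congr 1
      rw [← Finset.card_image_of_injective _ (add_left_injective (x - b))]
      congr 1
      ext z
      simp only [Finset.mem_image, Finset.mem_filter, Finset.mem_inter]
      constructor
      · rintro ⟨u, ⟨hu, hu'⟩, rfl⟩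
        exact ⟨hu', u, hu, rfl⟩
      · rintro ⟨hz, u, hu, rfl⟩
        exact ⟨u, ⟨hu, hz⟩, rfl⟩
    obtain ⟨C, hC, hab, hle⟩ := ih #{z ∈ B | z + (x - b) ∈ A}
      (Finset.card_lt_card (Finset.filter_ssubset.2 ⟨y, hy, by
        rwa [show y + (x - b) = y - b + x by abel]⟩))
      (A := A ∪ B.image (· + (x - b))) (Finset.mem_union_left _ ha)
      (B := {z ∈ B | z + (x - b) ∈ A}) (by simp [hb, hx]) rfl
    refine ⟨C, hC.trans ?_, hab, hcard ▸ hle⟩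
    intro w hw
    obtain ⟨u, hu, v, hv, rfl⟩ := Finset.mem_add.1 hw
    rw [Finset.mem_filter] at hv
    rcases Finset.mem_union.1 hu with hu | hu
    · exact Finset.add_mem_add hu hv.1
    · obtain ⟨t, ht, rfl⟩ := Finset.mem_image.1 hu
      rw [show t + (x - b) + v = (v + (x - b)) + t by abel]
      exact Finset.add_mem_add hv.2 ht

theorem card_add_card_le_card_add {A B : Finset G} (hA : A.Nonempty) (hB : B.Nonempty) :
    #A + #B ≤ #(A + B) + Nat.card (A + B).translationStab := by
  obtain ⟨a, ha⟩ := hA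
  obtain ⟨b, hb⟩ := hB
  obtain ⟨C₀, hC₀, -, hle₀⟩ := exists_mem_subset_add ha hb
  obtain ⟨C, hC, hmax⟩ := Finset.exists_max_image
    {C ∈ (A + B).powerset | #A + #B ≤ #C + Nat.card C.translationStab} Finset.card
    ⟨C₀, Finset.mem_filter.2 ⟨Finset.mem_powerset.2 hC₀, hle₀⟩⟩
  rw [Finset.mem_filter, Finset.mem_powerset] at hC
  suffices h : C = A + B from h ▸ hC.2
  by_contra hne
  obtain ⟨x, hx, hxC⟩ := Finset.exists_of_ssubset (hC.1.ssubset_of_ne hne)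
  obtain ⟨a', ha', b', hb', rfl⟩ := Finset.mem_add.1 hx
  obtain ⟨C', hC', hmem, hle'⟩ := exists_mem_subset_add ha' hb'
  have hss : C ⊂ C ∪ C' := Finset.subset_union_left.ssubset_of_ne fun h =>
    hxC (h ▸ Finset.mem_union_right _ hmem)
  have h₁ : ¬ C ⊆ C' := fun h => by
    have := hmax C' (Finset.mem_filter.2 ⟨Finset.mem_powerset.2 hC', hle'⟩)
    exact hxC (Finset.eq_of_subset_of_card_le h this ▸ hmem)
  have h₂ : ¬ C' ⊆ C := fun h => hxC (h hmem)
  have := hmax (C ∪ C') (by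
    rw [Finset.mem_filter, Finset.mem_powerset]
    exact ⟨Finset.union_subset hC.1 hC',
      le_card_union_add_card_translationStab h₁ h₂ hC.2 hle'⟩)
  exact absurd (Finset.card_lt_card hss) (by omega)


/-- The union of the cosets of `K` meeting `X`. -/
noncomputable def Finset.saturation (K : AddSubgroup G) (X : Finset G) : Finset G :=
  {g | ∃ x ∈ X, g - x ∈ K}

theorem Finset.mem_saturation {K : AddSubgroup G} {X : Finset G} {g : G} :
    g ∈ X.saturation K ↔ ∃ x ∈ X, g - x ∈ K := by
  simp [Finset.saturation]

theorem Finset.subset_saturation (K : AddSubgroup G) (X : Finset G) : X ⊆ X.saturation K :=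
  fun x hx => Finset.mem_saturation.2 ⟨x, hx, by simp⟩

theorem Finset.mem_saturation_of_sub_mem {K : AddSubgroup G} {X : Finset G} {g x : G}
    (hx : x ∈ X.saturation K) (h : g - x ∈ K) : g ∈ X.saturation K := by
  obtain ⟨y, hy, hxy⟩ := Finset.mem_saturation.1 hx
  exact Finset.mem_saturation.2 ⟨y, hy, by simpa using add_mem h hxy⟩

theorem Finset.le_translationStab_saturation (K : AddSubgroup G) (X : Finset G) :
    K ≤ (X.saturation K).translationStab :=
  AddSubgroup.le_translationStab fun _ hk _ hx =>
    Finset.mem_saturation_of_sub_mem hx (by simpa using hk)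

theorem Finset.saturation_add (K : AddSubgroup G) (X Y : Finset G) :
    X.saturation K + Y.saturation K = (X + Y).saturation K := by
  ext g
  simp only [Finset.mem_add, Finset.mem_saturation]
  constructor
  · rintro ⟨u, ⟨x, hx, hux⟩, v, ⟨y, hy, hvy⟩, rfl⟩
    exact ⟨x + y, ⟨x, hx, y, hy, rfl⟩, by simpa [add_sub_add_comm] using add_mem hux hvy⟩
  · rintro ⟨_, ⟨x, hx, y, hy, rfl⟩, h⟩
    exact ⟨g - y, ⟨x, hx, by rwa [sub_sub, add_comm y]⟩, y, ⟨y, hy, by simp⟩, by simp⟩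

theorem Finset.saturation_translationStab {K : AddSubgroup G} {X : Finset G} :
    X.saturation (X.saturation K).translationStab = X.saturation K := by
  ext g
  constructor
  · intro h
    obtain ⟨x, hx, hgx⟩ := Finset.mem_saturation.1 h
    have := (hgx x).2 (Finset.subset_saturation K X hx)
    rwa [sub_add_cancel] at this
  · intro h
    obtain ⟨x, hx, hgx⟩ := Finset.mem_saturation.1 h
    exact Finset.mem_saturation.2 ⟨x, hx, Finset.le_translationStab_saturation K X hgx⟩

theorem Finset.translationStab_saturation_of_add {K : AddSubgroup G} {X Y : Finset G}
    (h : ((X + Y).saturation K).translationStab = K) :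
    (X.saturation K).translationStab = K := by
  refine le_antisymm ?_ (Finset.le_translationStab_saturation K X)
  intro g hg
  rw [← h, ← Finset.saturation_add]
  apply Finset.mem_translationStab_of_forall_mem
  intro z hz
  obtain ⟨x, hx, y, hy, rfl⟩ := Finset.mem_add.1 hz
  rw [← add_assoc]
  exact Finset.add_mem_add ((hg x).2 hx) hy

/-- **Kneser's theorem**. -/
theorem card_saturation_add_card_saturation_le {K : AddSubgroup G} {X Y : Finset G}
    (hX : X.Nonempty) (hY : Y.Nonempty) (h : ((X + Y).saturation K).translationStab = K) :
    #(X.saturation K) + #(Y.saturation K) ≤ #((X + Y).saturation K) + Nat.card K := by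
  have := card_add_card_le_card_add (hX.mono (Finset.subset_saturation K X))
    (hY.mono (Finset.subset_saturation K Y))
  rwa [Finset.saturation_add, h] at this

/-- `Y` satisfies a Kneser-type bound with `n` summands of total weight `f`, relative to every
subgroup. -/
def KneserBound (Y : Finset G) (n : ℕ) (f : AddSubgroup G → ℕ) : Prop :=
  ∀ K : AddSubgroup G, (Y.saturation K).translationStab = K →
    Nat.card K + f K ≤ #(Y.saturation K) + n * Nat.card K

theorem KneserBound.add {X Y : Finset G} {m n : ℕ} {f g : AddSubgroup G → ℕ}
    (hX : KneserBound X m f) (hY : KneserBound Y n g) (hX₀ : X.Nonempty) (hY₀ : Y.Nonempty) :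
    KneserBound (X + Y) (m + n) (fun K => f K + g K) := by
  intro K hK
  have h₁ := hX K (Finset.translationStab_saturation_of_add hK)
  have h₂ := hY K (Finset.translationStab_saturation_of_add (add_comm X Y ▸ hK))
  have := card_saturation_add_card_saturation_le hX₀ hY₀ hK
  rw [add_mul]
  dsimp only
  omega

theorem KneserBound.sum {ι : Type*} (s : Finset ι) {Y : ι → Finset G} {n : ι → ℕ}
    {f : ι → AddSubgroup G → ℕ} (h : ∀ i, KneserBound (Y i) (n i) (f i))
    (hY : ∀ i, (Y i).Nonempty) :
    (∑ i ∈ s, Y i).Nonempty ∧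
      KneserBound (∑ i ∈ s, Y i) (∑ i ∈ s, n i) (fun K => ∑ i ∈ s, f i K) := by
  induction s using Finset.induction_on with
  | empty =>
    refine ⟨by simp, fun K _ => ?_⟩
    simp only [Finset.sum_empty, add_zero, zero_mul]
    exact AddSubgroup.card_le_card_of_add_mem ⟨0, Finset.subset_saturation _ _ (by simp)⟩
      fun k hk x hx => (Finset.le_translationStab_saturation K _ hk x).2 hx
  | insert i s hi ih =>
    simp only [Finset.sum_insert hi]
    exact ⟨(hY i).add ih.1, (h i).add ih.2 (hY i) ih.1⟩

/-- The finite set of sums of `n`-term subsequences of `S`. -/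
noncomputable def subseqSumsFinset (n : ℕ) (S : Multiset G) : Finset G :=
  {x | x ∈ subseqSums S n}

theorem mem_subseqSumsFinset {n : ℕ} {S : Multiset G} {x : G} :
    x ∈ subseqSumsFinset n S ↔ ∃ T ≤ S, Multiset.card T = n ∧ T.sum = x := by
  rw [subseqSumsFinset, Finset.mem_filter, and_iff_right (Finset.mem_univ x)]
  rfl

theorem subseqSumsFinset_nonempty {n : ℕ} {S : Multiset G} (h : n ≤ Multiset.card S) :
    (subseqSumsFinset n S).Nonempty := by
  obtain ⟨T, hT⟩ := Multiset.card_pos_iff_exists_mem.1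
    (Multiset.card_powersetCard n S ▸ Nat.choose_pos h)
  obtain ⟨hT, hn⟩ := Multiset.mem_powersetCard.1 hT
  exact ⟨T.sum, mem_subseqSumsFinset.2 ⟨T, hT, hn, rfl⟩⟩

theorem sum_cosetCount (K : AddSubgroup G) (S : Multiset G) :
    ∑ g, cosetCount K g S = Multiset.card S * Nat.card K := by
  induction S using Multiset.induction_on with
  | empty => simp [cosetCount]
  | cons a S ih =>
    simp only [cosetCount, Multiset.countP_cons, Finset.sum_add_distrib] at ih ⊢
    rw [ih, Multiset.card_cons, add_mul, one_mul, ← Finset.card_filter,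
      AddSubgroup.card_filter_sub_mem']

/-- The number of terms of `S` when at most `n` of them are counted from each coset of `K`,
multiplied by the order of `K`. -/
noncomputable def cosetWeight (n : ℕ) (S : Multiset G) (K : AddSubgroup G) : ℕ :=
  ∑ g, min n (cosetCount K g S)

theorem sum_cosetWeight_cosetPart {K L : AddSubgroup G} (h : L ≤ K) (S T : Multiset G) :
    ∑ q : G ⧸ K, cosetWeight (Multiset.card (cosetPart K q T)) (cosetPart K q S) L =
      ∑ g, min (cosetCount K g T) (cosetCount L g S) := by
  simp only [cosetWeight]
  rw [Finset.sum_comm]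
  refine Finset.sum_congr rfl fun g _ => ?_
  rw [Finset.sum_eq_single (g : G ⧸ K)]
  · rw [card_cosetPart, cosetCount_cosetPart h, if_pos rfl]
  · intro q _ hq
    rw [cosetCount_cosetPart h, if_neg hq.symm, Nat.min_zero]
  · simp

/-- The weight of one term from each coset meeting `B`, and at most `n - 1` remaining terms of `S`
from each coset. -/
noncomputable def splitWeight (n : ℕ) (S : Multiset G) (B : Finset G) (K : AddSubgroup G) : ℕ :=
  #(B.saturation K) + cosetWeight (n - 1) (S - B.val) K

theorem splitWeight_eq_sum (n : ℕ) (S : Multiset G) (B : Finset G) (K : AddSubgroup G) :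
    splitWeight n S B K = ∑ g, ((if g ∈ B.saturation K then 1 else 0) +
      min (n - 1) (cosetCount K g (S - B.val))) := by
  rw [splitWeight, cosetWeight, Finset.sum_add_distrib, ← Finset.card_filter]
  simp

theorem cosetCount_pos_iff {K : AddSubgroup G} {g : G} {B : Finset G} :
    0 < cosetCount K g B.val ↔ g ∈ B.saturation K := by
  rw [cosetCount, Multiset.countP_pos, Finset.mem_saturation]
  refine exists_congr fun b => and_congr Iff.rfl ?_
  rw [← neg_mem_iff, neg_sub]

/-- `B` is a set of terms of `S` that can be used as the first summand for the cosets of `K`. -/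
def IsFirstSummand (n : ℕ) (S : Multiset G) (B : Finset G) (K : AddSubgroup G) : Prop :=
  ∀ g ∈ B.saturation K, min n (cosetCount K g S) ≤ 1 + min (n - 1) (cosetCount K g (S - B.val))

theorem splitWeight_add_le {n : ℕ} (hn : 1 ≤ n) {S T : Multiset G} {B : Finset G}
    {K L : AddSubgroup G} (hLK : L ≤ K) (hBS : B.val ≤ S) (hB : IsFirstSummand n S B K)
    (hTS : T ≤ S) (hT : Multiset.card T = n) :
    splitWeight n S B L + n * Nat.card K ≤ splitWeight n S B K +
      ∑ g, min (cosetCount K g T) (cosetCount L g S) + Nat.card K := by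
  have hfull : #{g | cosetCount K g T = n} ≤ Nat.card K := by
    refine Nat.le_of_mul_le_mul_left ?_ hn
    rw [← hT, ← sum_cosetCount K T, hT, mul_comm, ← smul_eq_mul, ← Finset.sum_const]
    refine (Finset.sum_le_sum fun g hg => ?_).trans
      (Finset.sum_le_sum_of_subset (Finset.subset_univ {g | cosetCount K g T = n}))
    exact (Finset.mem_filter.1 hg).2.ge
  have hpt : ∀ g, (if g ∈ B.saturation L then 1 else 0) +
      min (n - 1) (cosetCount L g (S - B.val)) + cosetCount K g T ≤
      (if g ∈ B.saturation K then 1 else 0) + min (n - 1) (cosetCount K g (S - B.val)) +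
      min (cosetCount K g T) (cosetCount L g S) + if cosetCount K g T = n then 1 else 0 := by
    intro g
    have e₁ := cosetCount_sub_add hBS L g
    have e₂ := cosetCount_sub_add hBS K g
    have i₁ : g ∈ B.saturation L ↔ 0 < cosetCount L g B.val := cosetCount_pos_iff.symm
    have i₂ : g ∈ B.saturation K ↔ 0 < cosetCount K g B.val := cosetCount_pos_iff.symm
    have m₁ := cosetCount_mono hLK g B.val
    have m₂ := cosetCount_mono hLK g (S - B.val)
    have m₃ := cosetCount_le_of_le hTS K g
    have m₄ := (cosetCount_le_card K g T).trans_eq hT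
    have hBg := hB g
    rw [i₂] at hBg
    simp only [i₁, i₂]
    by_cases hK : 0 < cosetCount K g B.val
    · have := hBg hK
      split_ifs <;> omega
    · split_ifs <;> omega
  have e := sum_cosetCount K T
  rw [hT] at e
  rw [splitWeight_eq_sum n S B L, splitWeight_eq_sum n S B K, ← e, ← Finset.sum_add_distrib,
    ← Finset.sum_add_distrib]
  refine (Finset.sum_le_sum fun g _ => hpt g).trans (Finset.sum_add_distrib ..).le |>.trans ?_
  gcongr
  rwa [← Finset.card_filter]

/-- A periodic part of `subseqSumsFinset n S` that is large in terms of its stabilizer. -/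
structure IsConvergent (H : AddSubgroup G) (n : ℕ) (S : Multiset G) (B C : Finset G) : Prop where
  nonempty : C.Nonempty
  subset : C ⊆ (subseqSumsFinset n S).saturation H
  le_stab : H ≤ C.translationStab
  le_card : Nat.card C.translationStab + splitWeight n S B C.translationStab ≤
    #C + n * Nat.card C.translationStab

theorem IsConvergent.exists_smaller {H : AddSubgroup G} {n : ℕ} (hn : 1 ≤ n) {S : Multiset G}
    (ih : ∀ (m : ℕ) (T : Multiset G), m + Multiset.card T < n + Multiset.card S → m ≤ Multiset.card T →
      KneserBound (subseqSumsFinset m T) m (cosetWeight m T))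
    (hH : ((subseqSumsFinset n S).saturation H).translationStab = H)
    {B : Finset G} (hBS : B.val ≤ S) (hB : ∀ K, H ≤ K → IsFirstSummand n S B K)
    {C : Finset G} (hC : IsConvergent H n S B C) (hne : C.translationStab ≠ H) :
    ∃ C', IsConvergent H n S B C' ∧ C'.translationStab < C.translationStab := by
  set K := C.translationStab with hK
  set X := (subseqSumsFinset n S).saturation H with hX
  obtain ⟨T, hTS, hT, z, hz, hzX⟩ : ∃ T ≤ S, Multiset.card T = n ∧ ∃ z, z - T.sum ∈ K ∧ z ∉ X := by
    by_contra! hcon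
    refine hne (le_antisymm ?_ hC.le_stab)
    rw [← hH]
    refine AddSubgroup.le_translationStab fun k hk x hx => ?_
    obtain ⟨y, hy, hxy⟩ := Finset.mem_saturation.1 hx
    obtain ⟨T, hTS, hT, rfl⟩ := mem_subseqSumsFinset.1 hy
    exact hcon T hTS hT _ (by rw [add_sub_assoc]; exact add_mem hk (hC.le_stab hxy))
  have hCK : ∀ c ∈ C, c - T.sum ∉ K := fun c hc hcT => hzX <| hC.subset <| by
    have := sub_mem hz hcT
    rw [sub_sub_sub_cancel_right] at this
    simpa using (this c).2 hc
  set t : G ⧸ K → ℕ := fun q => Multiset.card (cosetPart K q T) with ht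
  set Y : G ⧸ K → Finset G := fun q => subseqSumsFinset (t q) (cosetPart K q S) with hY
  have ht_le : ∀ q, t q ≤ Multiset.card (cosetPart K q S) := fun q =>
    Multiset.card_le_card (Multiset.filter_le_filter _ hTS)
  have hsum_t : ∑ q, t q = n := by
    rw [← hT, ← Multiset.card_sum, sum_cosetPart]
  have hlt : ∀ q, t q + Multiset.card (cosetPart K q S) < n + Multiset.card S := by
    intro q
    have h₁ : t q ≤ n := hT ▸ Multiset.card_le_card (Multiset.filter_le _ _)
    have h₂ : Multiset.card (cosetPart K q S) ≤ Multiset.card S :=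
      Multiset.card_le_card (Multiset.filter_le _ _)
    by_contra! hge
    have hSq : cosetPart K q S = S :=
      Multiset.eq_of_le_of_card_le (Multiset.filter_le _ _) (by omega)
    obtain ⟨c, hc⟩ := hC.nonempty
    obtain ⟨y, hy, hcy⟩ := Finset.mem_saturation.1 (hC.subset hc)
    obtain ⟨U, hUS, hU, rfl⟩ := mem_subseqSumsFinset.1 hy
    refine hCK c hc ?_
    rw [← sub_add_sub_cancel c U.sum]
    refine add_mem (hC.le_stab hcy) (QuotientAddGroup.eq_iff_sub_mem.1 ?_)
    rw [mk_sum_cosetPart K q (hSq.symm ▸ hUS), mk_sum_cosetPart K q (hSq.symm ▸ hTS), hU, hT]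
  obtain ⟨-, hbound⟩ := KneserBound.sum Finset.univ (Y := Y) (fun q => ih _ _ (hlt q) (ht_le q))
    fun q => subseqSumsFinset_nonempty (ht_le q)
  rw [hsum_t] at hbound
  have hYmem : ∀ x ∈ ∑ q, Y q, x ∈ subseqSumsFinset n S ∧ x - T.sum ∈ K := by
    intro x hx
    rw [← Finset.mem_coe, Finset.coe_sum, Set.mem_fintype_sum] at hx
    obtain ⟨f, hf, rfl⟩ := hx
    choose U hU hUt hUf using fun q => mem_subseqSumsFinset.1 (Finset.mem_coe.1 (hf q))
    constructor
    · refine mem_subseqSumsFinset.2 ⟨∑ q, U q, ?_, ?_, ?_⟩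
      · exact (Finset.sum_le_sum fun q _ => hU q).trans_eq (sum_cosetPart K S)
      · rw [Multiset.card_sum, ← hsum_t]
        exact Finset.sum_congr rfl fun q _ => hUt q
      · rw [Multiset.sum_sum]
        exact Finset.sum_congr rfl fun q _ => hUf q
    · rw [← sum_cosetPart K T, Multiset.sum_sum, ← Finset.sum_sub_distrib]
      refine sum_mem fun q _ => QuotientAddGroup.eq_iff_sub_mem.1 ?_
      rw [← hUf, mk_sum_cosetPart K q (hU q), hUt, mk_sum_cosetPart K q le_rfl]
  have hTY : T.sum ∈ ∑ q, Y q := by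
    rw [← Finset.mem_coe, Finset.coe_sum, Set.mem_fintype_sum]
    refine ⟨fun q => (cosetPart K q T).sum, fun q => ?_, ?_⟩
    · exact mem_subseqSumsFinset.2 ⟨_, Multiset.filter_le_filter _ hTS, rfl, rfl⟩
    · rw [← Multiset.sum_sum, sum_cosetPart]
  set D := (∑ q, Y q).saturation H with hD
  have hDX : D ⊆ X := fun d hd => by
    obtain ⟨y, hy, hdy⟩ := Finset.mem_saturation.1 hd
    exact Finset.mem_saturation.2 ⟨y, (hYmem y hy).1, hdy⟩
  have hDK : ∀ d ∈ D, d - T.sum ∈ K := fun d hd => by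
    obtain ⟨y, hy, hdy⟩ := Finset.mem_saturation.1 hd
    rw [← sub_add_sub_cancel d y]
    exact add_mem (hC.le_stab hdy) (hYmem y hy).2
  have hTD : T.sum ∈ D := Finset.subset_saturation _ _ hTY
  have hstab : (C ∪ D).translationStab = D.translationStab :=
    translationStab_union hDK hTD (fun h => hzX (hDX h)) hz fun h => hCK _ h (by simp)
  have hDle : D.translationStab ≤ K := fun g hg => by
    have := hDK _ ((hg T.sum).2 hTD)
    rwa [add_sub_cancel_right] at this
  have hdisj : Disjoint C D := Finset.disjoint_left.2 fun c hc hcD => hCK c hc (hDK c hcD)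
  refine ⟨C ∪ D, ⟨hC.nonempty.mono Finset.subset_union_left,
    Finset.union_subset hC.subset hDX, ?_, ?_⟩, ?_⟩
  · rw [hstab]
    exact Finset.le_translationStab_saturation _ _
  · rw [hstab, Finset.card_union_of_disjoint hdisj]
    have h₁ := hbound D.translationStab
      (by rw [hD, Finset.saturation_translationStab])
    rw [hD, Finset.saturation_translationStab, ← hD] at h₁
    have e := sum_cosetWeight_cosetPart hDle S T
    simp only [ht] at h₁
    rw [e] at h₁
    have h₂ := splitWeight_add_le hn hDle hBS (hB K hC.le_stab) hTS hT
    have h₃ := hC.le_card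
    rw [← hK] at h₃
    omega
  · rw [hstab]
    refine lt_of_le_of_ne hDle fun h => hzX (hDX ?_)
    have := h.ge hz T.sum
    rwa [sub_add_cancel, iff_true_right hTD] at this

theorem exists_firstSummand (H : AddSubgroup G) {n : ℕ} (hn : 1 ≤ n) {S : Multiset G}
    (hS : n ≤ Multiset.card S) :
    ∃ B : Finset G, B.Nonempty ∧ B.val ≤ S ∧ (∀ K, H ≤ K → IsFirstSummand n S B K) ∧
      n - 1 ≤ Multiset.card (S - B.val) ∧ ∀ g ∉ B.saturation H, cosetCount H g S ≤ n - 1 := by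
  by_cases hheavy : ∃ g, n ≤ cosetCount H g S
  · have hrep : ∀ q : G ⧸ H, ∃ r : G, (r : G ⧸ H) = q ∧
        ((∃ s ∈ S, (s : G ⧸ H) = q) → r ∈ S) := by
      intro q
      by_cases h : ∃ s ∈ S, (s : G ⧸ H) = q
      · obtain ⟨s, hs, hq⟩ := h
        exact ⟨s, hq, fun _ => hs⟩
      · obtain ⟨r, hr⟩ := QuotientAddGroup.mk_surjective q
        exact ⟨r, hr, fun h' => absurd h' h⟩
    choose r hr hrS using hrep
    set B : Finset G := {g | n ≤ cosetCount H g S ∧ r g = g} with hBdef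
    have hmem : ∀ g, n ≤ cosetCount H g S → r g ∈ B := by
      intro g hg
      rw [hBdef, Finset.mem_filter]
      refine ⟨Finset.mem_univ _, ?_, by rw [hr]⟩
      rwa [cosetCount_congr (QuotientAddGroup.eq_iff_sub_mem.1 (hr g))]
    have hBS : B.val ≤ S := by
      rw [Finset.val_le_iff_val_subset]
      intro b hb
      have hb' := (Finset.mem_filter.1 (show b ∈ B from hb)).2
      rw [← hb'.2]
      apply hrS
      obtain ⟨s, hs, hsb⟩ := Multiset.countP_pos.1 (hn.trans hb'.1)
      exact ⟨s, hs, QuotientAddGroup.eq_iff_sub_mem.2 hsb⟩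
    have hcount : ∀ b ∈ B, n - 1 ≤ cosetCount H b (S - B.val) := by
      intro b hb
      have hb' := (Finset.mem_filter.1 hb).2
      have h₁ : cosetCount H b B.val ≤ 1 := by
        rw [cosetCount, Multiset.countP_eq_card_filter, ← Finset.filter_val, Finset.card_val,
          Finset.card_le_one]
        intro x hx y hy
        simp only [Finset.mem_filter] at hx hy
        have hxy : (x : G ⧸ H) = y := (QuotientAddGroup.eq_iff_sub_mem.2 hx.2).trans
          (QuotientAddGroup.eq_iff_sub_mem.2 hy.2).symm
        rw [← (Finset.mem_filter.1 hx.1).2.2, ← (Finset.mem_filter.1 hy.1).2.2, hxy]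
      have := cosetCount_sub_add hBS H b
      omega
    obtain ⟨g₀, hg₀⟩ := hheavy
    refine ⟨B, ⟨_, hmem g₀ hg₀⟩, hBS, fun K hHK g hg => ?_,
      (hcount _ (hmem g₀ hg₀)).trans (cosetCount_le_card _ _ _), fun g hg => ?_⟩
    · obtain ⟨b, hb, hgb⟩ := Finset.mem_saturation.1 hg
      have := (hcount b hb).trans (cosetCount_mono hHK b _)
      rw [← cosetCount_congr hgb] at this
      omega
    · by_contra! hlt
      exact hg (Finset.mem_saturation.2 ⟨_, hmem g (by omega),
        QuotientAddGroup.eq_iff_sub_mem.1 (hr g).symm⟩)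
  · push Not at hheavy
    obtain ⟨a, ha⟩ := Multiset.card_pos_iff_exists_mem.1 (hn.trans hS)
    have hBS : ({a} : Finset G).val ≤ S := by simpa using ha
    refine ⟨{a}, by simp, hBS, fun K _ g hg => ?_, ?_, fun g _ => ?_⟩
    · have h₁ := cosetCount_sub_add hBS K g
      have h₂ := cosetCount_le_card K g ({a} : Finset G).val
      simp only [Finset.card_val, Finset.card_singleton] at h₂
      omega
    · rw [Multiset.card_sub hBS]
      simp only [Finset.card_val, Finset.card_singleton]
      omega
    · have := hheavy g
      omega

theorem add_subseqSumsFinset_subset {n : ℕ} (hn : 1 ≤ n) {S : Multiset G} {B : Finset G}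
    (hBS : B.val ≤ S) : B + subseqSumsFinset (n - 1) (S - B.val) ⊆ subseqSumsFinset n S := by
  intro x hx
  obtain ⟨b, hb, y, hy, rfl⟩ := Finset.mem_add.1 hx
  obtain ⟨T, hT, hTn, rfl⟩ := mem_subseqSumsFinset.1 hy
  refine mem_subseqSumsFinset.2 ⟨{b} + T, ?_, ?_, by simp⟩
  · rw [← add_tsub_cancel_of_le hBS]
    exact add_le_add (Multiset.singleton_le.2 hb) hT
  · rw [Multiset.card_add, Multiset.card_singleton, hTn]
    omega

theorem le_splitWeight {H : AddSubgroup G} {n : ℕ} {S : Multiset G} {B : Finset G}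
    (hBS : B.val ≤ S) (hB : IsFirstSummand n S B H)
    (hlight : ∀ g ∉ B.saturation H, cosetCount H g S ≤ n - 1) :
    cosetWeight n S H ≤ splitWeight n S B H := by
  rw [splitWeight_eq_sum, cosetWeight]
  refine Finset.sum_le_sum fun g _ => ?_
  have h₁ := cosetCount_sub_add hBS H g
  split_ifs with hg
  · exact hB g hg
  · have h₂ := hlight g hg
    have h₃ := cosetCount_pos_iff.not.2 hg
    omega

/-- The **DeVos–Goddyn–Mohar theorem** for subsequence sums. -/
theorem kneserBound_subseqSumsFinset {n : ℕ} {S : Multiset G} (hS : n ≤ Multiset.card S) :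
    KneserBound (subseqSumsFinset n S) n (cosetWeight n S) := by
  induction hN : n + Multiset.card S using Nat.strong_induction_on generalizing n S with
  | _ N ih =>
  subst hN
  have ih' : ∀ (m : ℕ) (T : Multiset G), m + Multiset.card T < n + Multiset.card S → m ≤ Multiset.card T →
      KneserBound (subseqSumsFinset m T) m (cosetWeight m T) :=
    fun m T hlt hm => ih _ hlt hm rfl
  intro H hH
  rcases Nat.eq_zero_or_pos n with rfl | hn
  · simp only [cosetWeight, Nat.zero_min, Finset.sum_const_zero, add_zero, zero_mul]
    exact AddSubgroup.card_le_card_of_add_mem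
      ((subseqSumsFinset_nonempty hS).mono (Finset.subset_saturation _ _))
      fun k hk x hx => (Finset.le_translationStab_saturation H _ hk x).2 hx
  obtain ⟨B, hBne, hBS, hB, hcard, hlight⟩ := exists_firstSummand H hn hS
  set Z := B + subseqSumsFinset (n - 1) (S - B.val) with hZ
  have hsub := Multiset.card_le_card (Multiset.sub_le_self S B.val)
  have hBbound : KneserBound B 1 fun K => #(B.saturation K) := fun K _ => by
    rw [one_mul, add_comm]
  have hZbound : KneserBound Z n (splitWeight n S B) := by
    have := hBbound.add (ih' _ _ (by omega) hcard) hBne (subseqSumsFinset_nonempty hcard)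
    rwa [Nat.add_sub_cancel' hn] at this
  have hZne : Z.Nonempty := hBne.add (subseqSumsFinset_nonempty hcard)
  have hZconv : IsConvergent H n S B (Z.saturation H) := by
    refine ⟨hZne.mono (Finset.subset_saturation _ _), fun z hz => ?_,
      Finset.le_translationStab_saturation _ _, ?_⟩
    · obtain ⟨y, hy, hzy⟩ := Finset.mem_saturation.1 hz
      exact Finset.mem_saturation.2 ⟨y, add_subseqSumsFinset_subset hn hBS hy, hzy⟩
    · have := hZbound (Z.saturation H).translationStab
        (by rw [Finset.saturation_translationStab])
      rwa [Finset.saturation_translationStab] at this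
  obtain ⟨C, hC, hmin⟩ := Finset.exists_min_image {C | IsConvergent H n S B C}
    (fun C => Nat.card C.translationStab) ⟨_, Finset.mem_filter.2 ⟨Finset.mem_univ _, hZconv⟩⟩
  replace hC := (Finset.mem_filter.1 hC).2
  have hCH : C.translationStab = H := by
    by_contra hne
    obtain ⟨C', hC', hlt⟩ := hC.exists_smaller hn ih' hH hBS hB hne
    have h₁ := hmin C' (Finset.mem_filter.2 ⟨Finset.mem_univ _, hC'⟩)
    exact hlt.ne (AddSubgroup.eq_of_le_of_card_ge hlt.le h₁)
  have h₁ := hC.le_card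
  rw [hCH] at h₁
  have h₂ := le_splitWeight hBS (hB H le_rfl) hlight
  have h₃ := Finset.card_le_card hC.subset
  omega

theorem saturation_bot (X : Finset G) : X.saturation ⊥ = X := by
  ext g
  simp [Finset.mem_saturation, AddSubgroup.mem_bot, sub_eq_zero]

theorem cosetWeight_of_forall_le {n : ℕ} {S : Multiset G} {H : AddSubgroup G}
    (h : ∀ g, cosetCount H g S ≤ n) :
    cosetWeight n S H = Multiset.card S * Nat.card H := by
  rw [← sum_cosetCount, cosetWeight]
  exact Finset.sum_congr rfl fun g _ => min_eq_right (h g)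

theorem le_cosetWeight_of_le_cosetCount {n : ℕ} {S : Multiset G} {H : AddSubgroup G} {g : G}
    (hg : n ≤ cosetCount H g S) (h : ∀ g', g' - g ∉ H → cosetCount H g' S ≤ n) :
    (n + Multiset.card (S.filter fun x => x - g ∉ H)) * Nat.card H ≤ cosetWeight n S H := by
  rw [add_mul, ← sum_cosetCount, ← H.card_filter_sub_mem g, mul_comm, ← smul_eq_mul,
    ← Finset.sum_const, Finset.sum_filter, ← Finset.sum_add_distrib, cosetWeight]
  refine Finset.sum_le_sum fun x _ => ?_
  split_ifs with hx
  · have : cosetCount H x (S.filter fun x => x - g ∉ H) = 0 := by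
      rw [cosetCount, Multiset.countP_eq_zero]
      intro y hy hyx
      refine (Multiset.mem_filter.1 hy).2 ?_
      rw [← sub_add_sub_cancel y x]
      exact add_mem hyx hx
    rw [this, cosetCount_congr hx]
    omega
  · have h₁ := cosetCount_le_of_le (Multiset.filter_le (fun x => x - g ∉ H) S) H x
    have h₂ := h x hx
    omega

theorem le_cosetWeight_of_two {n : ℕ} {S : Multiset G} {H : AddSubgroup G} {g g' : G}
    (hg : n ≤ cosetCount H g S) (hg' : n ≤ cosetCount H g' S) (h : g' - g ∉ H) :
    (n + n) * Nat.card H ≤ cosetWeight n S H := by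
  rw [add_mul]
  nth_rw 1 [← H.card_filter_sub_mem g]
  rw [← H.card_filter_sub_mem g', mul_comm n, mul_comm n, ← smul_eq_mul, ← smul_eq_mul,
    ← Finset.sum_const, ← Finset.sum_const, Finset.sum_filter, Finset.sum_filter,
    ← Finset.sum_add_distrib, cosetWeight]
  refine Finset.sum_le_sum fun x _ => ?_
  split_ifs with h₁ h₂ h₂
  · refine absurd ?_ h
    have := sub_mem h₁ h₂
    rwa [sub_sub_sub_cancel_left] at this
  · rw [cosetCount_congr h₁]; omega
  · rw [cosetCount_congr h₂]; omega
  · omega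

end SubsequenceSums

open scoped Pointwise Classical in
theorem stmt_15 {G : Type*} [AddCommGroup G] [Fintype G]
    (hcyc : IsAddCyclic G) (p : ℕ) (hp : p = (Nat.card G).minFac)
    (n : ℕ) (hn : Nat.card G / p - 1 ≤ n)
    (S : Multiset G)
    (hlen : n + Nat.card G - 1 ≤ Multiset.card S)
    (hmult : ∀ x : G, S.count x ≤ n)
    (hcoset : ∀ H : AddSubgroup G, H ≠ ⊤ → ∀ α : G,
      Nat.card (G ⧸ H) - 1 ≤
        Multiset.card (S.filter fun x => x ∉ α +ᵥ (H : Set G))) :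
    subseqSums S n = Set.univ := by
  have hG : 0 < Nat.card G := Nat.card_pos
  have hS : n ≤ Multiset.card S := by omega
  set X := (subseqSumsFinset n S).saturation ⊥ with hX
  set H := X.translationStab with hH
  suffices hXu : X = Finset.univ by
    rw [hX, saturation_bot] at hXu
    refine Set.eq_univ_of_forall fun x => ?_
    exact mem_subseqSumsFinset.1 (hXu ▸ Finset.mem_univ x)
  rcases eq_or_ne H ⊤ with htop | htop
  · obtain ⟨x, hx⟩ := (subseqSumsFinset_nonempty hS).mono (Finset.subset_saturation ⊥ _)
    refine Finset.eq_univ_of_forall fun y => ?_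
    have hy : y - x ∈ H := htop ▸ AddSubgroup.mem_top _
    simpa using (hy x).2 hx
  have hcard : Nat.card (G ⧸ H) * Nat.card H = Nat.card G :=
    (AddSubgroup.card_eq_card_quotient_mul_card_addSubgroup H).symm
  have hq : 0 < Nat.card (G ⧸ H) := Nat.card_pos
  have hh : 0 < Nat.card H := Nat.card_pos
  have hbound : Nat.card H + cosetWeight n S H ≤ X.card + n * Nat.card H := by
    have := kneserBound_subseqSumsFinset hS H (by rw [hH, hX, Finset.saturation_translationStab])
    rwa [hH, hX, Finset.saturation_translationStab] at this
  suffices hw : (n + (Nat.card (G ⧸ H) - 1)) * Nat.card H ≤ cosetWeight n S H by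
    refine Finset.eq_univ_of_card _ (le_antisymm (Finset.card_le_univ _) ?_)
    rw [← Nat.card_eq_fintype_card, ← hcard]
    obtain ⟨k, hk⟩ : ∃ k, Nat.card (G ⧸ H) = k + 1 := ⟨_, (Nat.sub_add_cancel hq).symm⟩
    rw [hk] at hw ⊢
    rw [Nat.add_sub_cancel] at hw
    nlinarith
  by_cases hall : ∀ g, cosetCount H g S ≤ n
  · rw [cosetWeight_of_forall_le hall]
    gcongr
    have : Nat.card (G ⧸ H) ≤ Nat.card G := hcard ▸ Nat.le_mul_of_pos_right _ hh
    omega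
  push Not at hall
  obtain ⟨g, hg⟩ := hall
  by_cases htwo : ∀ g', g' - g ∉ H → cosetCount H g' S ≤ n
  · refine le_trans ?_ (le_cosetWeight_of_le_cosetCount hg.le htwo)
    gcongr
    refine (hcoset H htop g).trans_eq ?_
    congr 1
    refine Multiset.filter_congr fun x _ => ?_
    rw [Set.mem_vadd_set_iff_neg_vadd_mem, vadd_eq_add, neg_add_eq_sub, SetLike.mem_coe]
  · push Not at htwo
    obtain ⟨g', hg'g, hg'⟩ := htwo
    refine le_trans ?_ (le_cosetWeight_of_two hg.le hg'.le hg'g)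
    have hbot : Nat.card H ≠ 1 := by
      intro h
      rw [AddSubgroup.card_eq_one] at h
      refine absurd (hmult g) (not_le.2 (hg.trans_eq ?_))
      rw [h, cosetCount, Multiset.count]
      refine Multiset.countP_congr rfl fun s _ => ?_
      simp only [AddSubgroup.mem_bot, sub_eq_zero, eq_comm]
    have hp_le : p ≤ Nat.card H := hp ▸
      Nat.minFac_le_of_dvd (by omega) (Dvd.intro_left _ hcard)
    have hp_pos : 0 < p := hp ▸ Nat.minFac_pos _
    have : Nat.card (G ⧸ H) ≤ Nat.card G / p :=
      (Nat.le_div_iff_mul_le hp_pos).2 (hcard ▸ Nat.mul_le_mul_left _ hp_le)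
    gcongr
    omega
end
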